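/- Assume S ⊆ {full, almost-full, bowtie}. Let G be a 2-connected graph, {s,s'} a 2-separator of G, and (X1,X2) a separation induced by {s,s'}. Let G1 := G[X1] + {s t1, t1 s'} and G2 := G[X2] + {s t2, t2 s'}, where t1 and t2 are new vertices (if ss' ∈ E(G) then ss' is an edge of both G1 and G2). Then G is S-restricted if and only if both G1 and G2 are S-restricted. -/

import Mathlib

open scoped unitInterval

namespace OnePlanarity

/-- The six crossing types of a crossing in a 1-planar drawing. -/
inductive CrossingType : Type
  | full | almostFull | bowtie | arrow | chair | timesCross
  deriving DecidableEq

/-- The three crossing types in which the four endpoints of the crossing edges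
lie on a common 4-cycle using the two crossing edges. -/
def goodTypes : Set CrossingType :=
  {CrossingType.full, CrossingType.almostFull, CrossingType.bowtie}

/-- The three "bad" crossing types. -/
def badTypes : Set CrossingType :=
  {CrossingType.arrow, CrossingType.chair, CrossingType.timesCross}

variable {V : Type*} {W : Type*}

/-- `HasCrossingType G a b c d t` says that, assuming the edges `ab` and `cd` of `G`
cross, the subgraph of `G` induced by `{a,b,c,d}` witnesses the crossing type `t`. -/
def HasCrossingType (G : SimpleGraph V) (a b c d : V) : CrossingType → Prop
  | .full => G.Adj a c ∧ G.Adj a d ∧ G.Adj b c ∧ G.Adj b d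
  | .almostFull =>
      (¬G.Adj a c ∧ G.Adj a d ∧ G.Adj b c ∧ G.Adj b d) ∨
      (G.Adj a c ∧ ¬G.Adj a d ∧ G.Adj b c ∧ G.Adj b d) ∨
      (G.Adj a c ∧ G.Adj a d ∧ ¬G.Adj b c ∧ G.Adj b d) ∨
      (G.Adj a c ∧ G.Adj a d ∧ G.Adj b c ∧ ¬G.Adj b d)
  | .bowtie =>
      (G.Adj a c ∧ G.Adj b d ∧ ¬G.Adj a d ∧ ¬G.Adj b c) ∨
      (G.Adj a d ∧ G.Adj b c ∧ ¬G.Adj a c ∧ ¬G.Adj b d)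
  | .arrow =>
      (G.Adj a c ∧ G.Adj a d ∧ ¬G.Adj b c ∧ ¬G.Adj b d) ∨
      (G.Adj b c ∧ G.Adj b d ∧ ¬G.Adj a c ∧ ¬G.Adj a d) ∨
      (G.Adj a c ∧ G.Adj b c ∧ ¬G.Adj a d ∧ ¬G.Adj b d) ∨
      (G.Adj a d ∧ G.Adj b d ∧ ¬G.Adj a c ∧ ¬G.Adj b c)
  | .chair =>
      (G.Adj a c ∧ ¬G.Adj a d ∧ ¬G.Adj b c ∧ ¬G.Adj b d) ∨
      (¬G.Adj a c ∧ G.Adj a d ∧ ¬G.Adj b c ∧ ¬G.Adj b d) ∨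
      (¬G.Adj a c ∧ ¬G.Adj a d ∧ G.Adj b c ∧ ¬G.Adj b d) ∨
      (¬G.Adj a c ∧ ¬G.Adj a d ∧ ¬G.Adj b c ∧ G.Adj b d)
  | .timesCross => ¬G.Adj a c ∧ ¬G.Adj a d ∧ ¬G.Adj b c ∧ ¬G.Adj b d

/-- `IsArc A x y` says that `A` is the image of a simple curve from `x` to `y`. -/
def IsArc (A : Set (ℝ × ℝ)) (x y : ℝ × ℝ) : Prop :=
  ∃ f : I → ℝ × ℝ, Continuous f ∧ Function.Injective f ∧
    f 0 = x ∧ f 1 = y ∧ Set.range f = A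

/-- A drawing of a graph `G` in the plane: vertices are mapped to distinct points,
every edge is mapped to a simple curve between the images of its endpoints avoiding the
images of all other vertices, and two edges intersect in finitely many points. -/
structure Drawing (G : SimpleGraph V) where
  pos : V → ℝ × ℝ
  pos_inj : Function.Injective pos
  arc : Sym2 V → Set (ℝ × ℝ)
  arc_curve : ∀ e ∈ G.edgeSet, ∀ u v : V, e = s(u, v) → IsArc (arc e) (pos u) (pos v)
  arc_avoid : ∀ e ∈ G.edgeSet, ∀ w : V, pos w ∈ arc e → w ∈ e
  arc_finite_inter : ∀ e ∈ G.edgeSet, ∀ e' ∈ G.edgeSet, e ≠ e' →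
    (arc e ∩ arc e').Finite

variable {G : SimpleGraph V}

/-- `D.Crosses e e' p` : the distinct edges `e` and `e'` of `G` cross at the point `p`
(an intersection point of their curves which is not the image of a vertex). -/
def Drawing.Crosses (D : Drawing G) (e e' : Sym2 V) (p : ℝ × ℝ) : Prop :=
  e ∈ G.edgeSet ∧ e' ∈ G.edgeSet ∧ e ≠ e' ∧
    p ∈ D.arc e ∧ p ∈ D.arc e' ∧ p ∉ Set.range D.pos

/-- A drawing is 1-planar if every edge is involved in at most one crossing and
adjacent edges do not cross. -/
def Drawing.IsOnePlanar (D : Drawing G) : Prop :=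
  (∀ e e₁ e₂ p q, D.Crosses e e₁ p → D.Crosses e e₂ q → e₁ = e₂ ∧ p = q) ∧
  (∀ e e' p, D.Crosses e e' p → ∀ v : V, v ∈ e → v ∉ e')

/-- A drawing is `S`-restricted if it is 1-planar and every crossing has a type in `S`. -/
def Drawing.IsSRestricted (D : Drawing G) (S : Set CrossingType) : Prop :=
  D.IsOnePlanar ∧
  ∀ a b c d : V, ∀ p : ℝ × ℝ, D.Crosses s(a, b) s(c, d) p →
    ∃ t ∈ S, HasCrossingType G a b c d t

/-- A graph is 1-planar if it admits a 1-planar drawing. -/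
def IsOnePlanarGraph (G : SimpleGraph V) : Prop :=
  ∃ D : Drawing G, D.IsOnePlanar

/-- A graph is `S`-restricted if it admits an `S`-restricted drawing. -/
def SRestricted (G : SimpleGraph V) (S : Set CrossingType) : Prop :=
  ∃ D : Drawing G, D.IsSRestricted S

/-- A planar graph: one admitting a crossing-free drawing. -/
def IsPlanarGraph (G : SimpleGraph V) : Prop :=
  ∃ D : Drawing G, ∀ e e' p, ¬ D.Crosses e e' p

/-- A drawing is geometric if every edge is drawn as a straight-line segment. -/
def Drawing.IsGeometric (D : Drawing G) : Prop :=
  ∀ u v : V, G.Adj u v → D.arc s(u, v) = segment ℝ (D.pos u) (D.pos v)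

/-- The point set of a drawing. -/
def Drawing.image (D : Drawing G) : Set (ℝ × ℝ) :=
  Set.range D.pos ∪ ⋃ e ∈ G.edgeSet, D.arc e

/-- The set of points of the outer (unbounded) face of a point set `A`. -/
def outerRegion (A : Set (ℝ × ℝ)) : Set (ℝ × ℝ) :=
  {x | x ∉ A ∧ ¬ Bornology.IsBounded (connectedComponentIn Aᶜ x)}

/-- `Inside γ x` : the point `x` is separated from the outer face by the closed curve `γ`. -/
def Inside (γ : Set (ℝ × ℝ)) (x : ℝ × ℝ) : Prop :=
  x ∉ γ ∧ Bornology.IsBounded (connectedComponentIn γᶜ x)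

/-- A vertex lies on (the boundary of) the outer face of a drawing. -/
def Drawing.OnOuterFace (D : Drawing G) (v : V) : Prop :=
  D.pos v ∈ closure (outerRegion D.image)

/-- Two vertices are cofacial: they lie on the boundary of a common face. -/
def Drawing.Cofacial (D : Drawing G) (u v : V) : Prop :=
  ∃ p : ℝ × ℝ, p ∉ D.image ∧
    D.pos u ∈ closure (connectedComponentIn D.imageᶜ p) ∧
    D.pos v ∈ closure (connectedComponentIn D.imageᶜ p)

/-- A graph admits a geometric `S`-restricted drawing. -/
def GeoSRestricted (G : SimpleGraph V) (S : Set CrossingType) : Prop :=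
  ∃ D : Drawing G, D.IsGeometric ∧ D.IsSRestricted S

/-- `OGeoSRestricted G S O` : the graph `G` admits a geometric `S`-restricted drawing
in which the vertex of `O` (if any) lies on the outer face. -/
def OGeoSRestricted (G : SimpleGraph V) (S : Set CrossingType) (O : Set V) : Prop :=
  ∃ D : Drawing G, D.IsGeometric ∧ D.IsSRestricted S ∧ ∀ v ∈ O, D.OnOuterFace v

/-- `k`-connectivity. -/
def KConnected (k : ℕ) (G : SimpleGraph V) : Prop :=
  k < Nat.card V ∧ ∀ T : Set V, T.ncard < k → (G.induce Tᶜ).Connected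

/-- A vertex has degree exactly two. -/
def DegTwo (G : SimpleGraph V) (w : V) : Prop :=
  ∃ a b : V, a ≠ b ∧ G.neighborSet w = {a, b}

/-- The simple graph obtained from `G` by suppressing the degree-2 vertices in `W`. -/
def suppress (G : SimpleGraph V) (Ws : Set V) : SimpleGraph {v : V // v ∉ Ws} :=
  SimpleGraph.fromRel (fun a b =>
    G.Adj a.1 b.1 ∨ ∃ w ∈ Ws, G.Adj w a.1 ∧ G.Adj w b.1)

/-- A graph is internally 3-connected if it is obtained from a 3-connected (multi)graph by
subdividing a subset of its edges once each. -/
def InternallyThreeConnected (G : SimpleGraph V) : Prop :=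
  ∃ Ws : Set V, (∀ w ∈ Ws, DegTwo G w) ∧ (∀ w ∈ Ws, ∀ u ∈ Ws, ¬ G.Adj w u) ∧
    KConnected 3 (suppress G Ws)

/-- `IsSeparation G T X₁ X₂` : `(X₁, X₂)` is a separation of `G` induced by the separator `T`. -/
def IsSeparation (G : SimpleGraph V) (T X₁ X₂ : Set V) : Prop :=
  X₁ ∪ X₂ = Set.univ ∧ X₁ ∩ X₂ = T ∧ (X₁ \ T).Nonempty ∧ (X₂ \ T).Nonempty ∧
  ∀ u ∈ X₁ \ T, ∀ v ∈ X₂ \ T, ∀ p : G.Walk u v, ∃ w ∈ T, w ∈ p.support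

end OnePlanarity
namespace OnePlanarity

variable {V : Type*}

/-- A block (2-connected component) of `G`: a maximal vertex set inducing a connected
subgraph without a cutvertex. -/
def IsBlock (G : SimpleGraph V) (B : Set V) : Prop :=
  B.Nonempty ∧ (G.induce B).Preconnected ∧
    (∀ v : V, (G.induce (B \ {v})).Preconnected) ∧
    ∀ B' : Set V, B ⊆ B' → B'.Nonempty → (G.induce B').Preconnected →
      (∀ v : V, (G.induce (B' \ {v})).Preconnected) → B = B'

/-- The graph `G[X] + {s t, t s'}` obtained from the induced subgraph `G[X]` by adding a
new vertex `t` (the `Sum.inr` vertex) adjacent exactly to `s` and `s'`. -/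
def augment (G : SimpleGraph V) (X : Set V) (s s' : V) : SimpleGraph (↥X ⊕ Unit) :=
  SimpleGraph.fromRel (fun a b =>
    (∃ u v : X, a = Sum.inl u ∧ b = Sum.inl v ∧ G.Adj u.1 v.1) ∨
    (∃ u : X, a = Sum.inl u ∧ ((u : V) = s ∨ (u : V) = s') ∧ b = Sum.inr ()))

/-- The copy of a set `O ⊆ V` inside the vertex set of `augment G X s s'`. -/
def liftO (X O : Set V) : Set (↥X ⊕ Unit) :=
  {x | ∃ u : X, x = Sum.inl u ∧ (u : V) ∈ O}

end OnePlanarity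
namespace OnePlanarity

section

variable {W : Type*}

/-! ### Simple arcs -/

theorem isArc_image_Icc {f : ℝ → ℝ × ℝ} {a b : ℝ} (hab : a < b)
    (hf : ContinuousOn f (Set.Icc a b)) (hi : Set.InjOn f (Set.Icc a b)) :
    IsArc (f '' Set.Icc a b) (f a) (f b) := by
  have hm : ∀ t : I, a + t * (b - a) ∈ Set.Icc a b := fun t =>
    ⟨by nlinarith [t.2.1], by nlinarith [t.2.2]⟩
  refine ⟨fun t => f (a + t * (b - a)), ?_, ?_, by simp, by simp, ?_⟩
  · exact hf.comp_continuous (by fun_prop) hm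
  · intro t u h
    have := hi (hm t) (hm u) h
    have h2 : (t : ℝ) * (b - a) = u * (b - a) := by linarith
    exact Subtype.ext (mul_right_cancel₀ (by linarith : b - a ≠ 0) h2)
  · ext z
    constructor
    · rintro ⟨t, rfl⟩
      exact ⟨_, hm t, rfl⟩
    · rintro ⟨x, hx, rfl⟩
      have hd : 0 < b - a := by linarith
      refine ⟨⟨(x - a) / (b - a), div_nonneg (by linarith [hx.1]) hd.le,
        (div_le_one hd).2 (by linarith [hx.2])⟩, ?_⟩
      simp only
      congr 1
      field_simp
      ring

theorem IsArc.exists_param {A : Set (ℝ × ℝ)} {x y : ℝ × ℝ} (h : IsArc A x y) :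
    ∃ f : ℝ → ℝ × ℝ, ContinuousOn f (Set.Icc 0 1) ∧ Set.InjOn f (Set.Icc 0 1) ∧
      f 0 = x ∧ f 1 = y ∧ f '' Set.Icc 0 1 = A := by
  obtain ⟨f, hc, hi, h0, h1, hr⟩ := h
  have key : ∀ t (ht : t ∈ Set.Icc (0 : ℝ) 1),
      f (Set.projIcc 0 1 zero_le_one t) = f ⟨t, ht⟩ := fun t ht => by
    rw [Set.projIcc_of_mem _ ht]
  refine ⟨fun t => f (Set.projIcc 0 1 zero_le_one t), ?_, ?_, ?_, ?_, ?_⟩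
  · exact (hc.comp continuous_projIcc).continuousOn
  · intro t ht u hu h
    simp only [key t ht, key u hu] at h
    exact congrArg Subtype.val (hi h)
  · simpa using h0
  · simpa using h1
  · rw [← hr]
    ext z
    constructor
    · rintro ⟨t, ht, rfl⟩
      exact ⟨_, rfl⟩
    · rintro ⟨t, rfl⟩
      exact ⟨t, t.2, key t t.2⟩

theorem IsArc.left_mem {A : Set (ℝ × ℝ)} {x y : ℝ × ℝ} (h : IsArc A x y) : x ∈ A := by
  obtain ⟨f, -, -, rfl, -, rfl⟩ := h
  exact ⟨0, rfl⟩

theorem IsArc.right_mem {A : Set (ℝ × ℝ)} {x y : ℝ × ℝ} (h : IsArc A x y) : y ∈ A := by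
  obtain ⟨f, -, -, -, rfl, rfl⟩ := h
  exact ⟨1, rfl⟩

theorem IsArc.ne {A : Set (ℝ × ℝ)} {x y : ℝ × ℝ} (h : IsArc A x y) : x ≠ y := by
  obtain ⟨f, -, hi, rfl, rfl, -⟩ := h
  exact fun h => zero_ne_one (hi h)

theorem IsArc.isCompact {A : Set (ℝ × ℝ)} {x y : ℝ × ℝ} (h : IsArc A x y) : IsCompact A := by
  obtain ⟨f, hc, -, -, -, rfl⟩ := h
  exact isCompact_range hc

theorem IsArc.symm {A : Set (ℝ × ℝ)} {x y : ℝ × ℝ} (h : IsArc A x y) : IsArc A y x := by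
  obtain ⟨f, hc, hi, h0, h1, rfl⟩ := h
  refine ⟨f ∘ σ, hc.comp unitInterval.continuous_symm,
    hi.comp unitInterval.symm_bijective.1, by simpa, by simpa, ?_⟩
  exact unitInterval.symm_bijective.2.range_comp f

theorem IsArc.image {A : Set (ℝ × ℝ)} {x y : ℝ × ℝ} (h : IsArc A x y)
    {Φ : ℝ × ℝ → ℝ × ℝ} (hΦ : ContinuousOn Φ A) (hi : Set.InjOn Φ A) :
    IsArc (Φ '' A) (Φ x) (Φ y) := by
  obtain ⟨f, hc, hfi, rfl, rfl, rfl⟩ := h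
  refine ⟨Φ ∘ f, hΦ.comp_continuous hc fun t => ⟨t, rfl⟩, ?_, rfl, rfl, Set.range_comp Φ f⟩
  exact fun t u h => hfi (hi ⟨t, rfl⟩ ⟨u, rfl⟩ h)

theorem IsArc.trans {A B : Set (ℝ × ℝ)} {x y z : ℝ × ℝ} (hA : IsArc A x y) (hB : IsArc B y z)
    (hAB : A ∩ B ⊆ {y}) : IsArc (A ∪ B) x z := by
  obtain ⟨f, hfc, hfi, rfl, rfl, rfl⟩ := hA.exists_param
  obtain ⟨g, hgc, hgi, hg0, rfl, rfl⟩ := hB.exists_param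
  set h : ℝ → ℝ × ℝ := fun t => if t ≤ 1 then f t else g (t - 1) with hdef
  have h1 : ∀ t ∈ Set.Icc (0 : ℝ) 1, h t = f t := fun t ht => by simp [hdef, ht.2]
  have h2 : ∀ t ∈ Set.Icc (1 : ℝ) 2, h t = g (t - 1) := fun t ht => by
    rcases eq_or_lt_of_le ht.1 with rfl | hlt
    · simp [hdef, hg0]
    · simp [hdef, not_le.2 hlt]
  have hsh : ∀ t ∈ Set.Icc (1 : ℝ) 2, t - 1 ∈ Set.Icc (0 : ℝ) 1 := fun t ht =>
    ⟨by linarith [ht.1], by linarith [ht.2]⟩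
  have hU : Set.Icc (0 : ℝ) 2 = Set.Icc 0 1 ∪ Set.Icc 1 2 :=
    (Set.Icc_union_Icc_eq_Icc (by norm_num) (by norm_num)).symm
  have c1 : ContinuousOn h (Set.Icc 0 1) := hfc.congr h1
  have c2 : ContinuousOn h (Set.Icc 1 2) :=
    (hgc.comp (by fun_prop : ContinuousOn (fun t : ℝ => t - 1) _) hsh).congr h2
  have hc : ContinuousOn h (Set.Icc 0 2) := by
    rw [hU]
    exact c1.union_of_isClosed c2 isClosed_Icc isClosed_Icc
  have mixed : ∀ t ∈ Set.Icc (0 : ℝ) 1, ∀ u ∈ Set.Icc (1 : ℝ) 2, h t = h u → t = u := by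
    intro t ht u hu e
    rw [h1 t ht, h2 u hu] at e
    have hy : f t = f 1 := hAB ⟨⟨t, ht, rfl⟩, ⟨u - 1, hsh u hu, e.symm⟩⟩
    have ht1 : t = 1 := hfi ht ⟨by norm_num, le_rfl⟩ hy
    have hu1 : u - 1 = 0 := hgi (hsh u hu) ⟨le_rfl, by norm_num⟩ (by rw [← e, hy, hg0])
    linarith
  have hi : Set.InjOn h (Set.Icc 0 2) := by
    rw [hU]
    rintro t (ht | ht) u (hu | hu) e
    · rw [h1 t ht, h1 u hu] at e
      exact hfi ht hu e
    · exact mixed t ht u hu e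
    · exact (mixed u hu t ht e.symm).symm
    · rw [h2 t ht, h2 u hu] at e
      linarith [hgi (hsh t ht) (hsh u hu) e]
  have := isArc_image_Icc (by norm_num) hc hi
  rw [h1 0 (by simp), h2 2 (by norm_num), hU, Set.image_union] at this
  convert this using 1
  · congr 1
    · exact (Set.image_congr h1).symm
    · rw [Set.image_congr h2, ← Set.image_image g (fun t : ℝ => t - 1)]
      congr 1
      simp
      norm_num
  · norm_num

theorem IsArc.split {A : Set (ℝ × ℝ)} {x y p : ℝ × ℝ} (h : IsArc A x y) (hp : p ∈ A)
    (hpx : p ≠ x) (hpy : p ≠ y) :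
    ∃ B C, A = B ∪ C ∧ B ∩ C = {p} ∧ IsArc B x p ∧ IsArc C p y := by
  obtain ⟨f, hc, hi, rfl, rfl, rfl⟩ := h.exists_param
  obtain ⟨t, ht, rfl⟩ := hp
  have ht0 : 0 < t := lt_of_le_of_ne ht.1 (by rintro rfl; exact hpx rfl)
  have ht1 : t < 1 := lt_of_le_of_ne ht.2 (by rintro rfl; exact hpy rfl)
  have s1 : Set.Icc 0 t ⊆ Set.Icc (0 : ℝ) 1 := Set.Icc_subset_Icc_right ht.2
  have s2 : Set.Icc t 1 ⊆ Set.Icc (0 : ℝ) 1 := Set.Icc_subset_Icc_left ht.1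
  refine ⟨f '' Set.Icc 0 t, f '' Set.Icc t 1, ?_, ?_,
    isArc_image_Icc ht0 (hc.mono s1) (hi.mono s1), isArc_image_Icc ht1 (hc.mono s2) (hi.mono s2)⟩
  · rw [← Set.image_union, Set.Icc_union_Icc_eq_Icc ht.1 ht.2]
  · rw [← hi.image_inter s1 s2, Set.Icc_inter_Icc_eq_singleton ht.1 ht.2, Set.image_singleton]

/-- The initial piece of an arc, up to the first time a continuous function drops to `c`. -/
theorem IsArc.exists_first_le {A : Set (ℝ × ℝ)} {x y : ℝ × ℝ} (h : IsArc A x y)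
    {g : ℝ × ℝ → ℝ} (hg : Continuous g) {c : ℝ} (hx : c < g x) (hy : g y ≤ c) :
    ∃ z ∈ A, ∃ B ⊆ A, IsArc B x z ∧ g z = c ∧ ∀ w ∈ B, w ≠ z → c < g w := by
  obtain ⟨f, hc, hi, rfl, rfl, rfl⟩ := h.exists_param
  have hgc : ContinuousOn (g ∘ f) (Set.Icc 0 1) := hg.comp_continuousOn hc
  have hK : IsCompact (Set.Icc (0 : ℝ) 1 ∩ (g ∘ f) ⁻¹' {c}) :=
    isCompact_Icc.of_isClosed_subset
      (hgc.preimage_isClosed_of_isClosed isClosed_Icc isClosed_singleton) Set.inter_subset_left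
  have hne : (Set.Icc (0 : ℝ) 1 ∩ (g ∘ f) ⁻¹' {c}).Nonempty := by
    obtain ⟨t, ht, e⟩ := intermediate_value_Icc' zero_le_one hgc ⟨hy, hx.le⟩
    exact ⟨t, ht, e⟩
  obtain ⟨t, ⟨ht, hct⟩, hmin⟩ := hK.exists_isLeast hne
  simp only [Set.mem_preimage, Function.comp, Set.mem_singleton_iff] at hct
  have ht0 : 0 < t := lt_of_le_of_ne ht.1 (by rintro rfl; exact hx.ne' hct)
  have s1 : Set.Icc 0 t ⊆ Set.Icc (0 : ℝ) 1 := Set.Icc_subset_Icc_right ht.2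
  refine ⟨f t, ⟨t, ht, rfl⟩, f '' Set.Icc 0 t, Set.image_mono s1,
    isArc_image_Icc ht0 (hc.mono s1) (hi.mono s1), hct, ?_⟩
  rintro _ ⟨u, hu, rfl⟩ hne
  by_contra! hle
  have s2 : Set.Icc 0 u ⊆ Set.Icc (0 : ℝ) 1 := Set.Icc_subset_Icc_right (hu.2.trans ht.2)
  obtain ⟨v, hv, e⟩ := intermediate_value_Icc' hu.1 (hgc.mono s2) ⟨hle, hx.le⟩
  have := hmin ⟨s2 hv, e⟩
  exact hne (by rw [le_antisymm hu.2 (this.trans hv.2)])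

theorem IsArc.exists_first_hit {A C : Set (ℝ × ℝ)} {x y : ℝ × ℝ} (h : IsArc A x y)
    (hC : IsClosed C) (hx : x ∉ C) (hy : y ∈ C) :
    ∃ z ∈ C, ∃ B ⊆ A, IsArc B x z ∧ B ∩ C ⊆ {z} := by
  have hne : C.Nonempty := ⟨y, hy⟩
  obtain ⟨z, -, B, hBA, hB, hz, hBC⟩ := h.exists_first_le
    (Metric.continuous_infDist_pt C) (c := 0)
    ((hC.notMem_iff_infDist_pos hne).1 hx) (Metric.infDist_zero_of_mem hy).le
  refine ⟨z, (hC.mem_iff_infDist_zero hne).2 hz, B, hBA, hB, ?_⟩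
  rintro w ⟨hwB, hwC⟩
  by_contra hwz
  exact (hBC w hwB hwz).ne' (Metric.infDist_zero_of_mem hwC)

theorem IsArc.join {A B : Set (ℝ × ℝ)} {x y z : ℝ × ℝ} (hA : IsArc A x y) (hB : IsArc B y z)
    (hxz : x ≠ z) : ∃ C ⊆ A ∪ B, IsArc C x z := by
  by_cases hx : x ∈ B
  · obtain ⟨B₁, B₂, rfl, -, -, h2⟩ := hB.split hx hA.ne hxz
    exact ⟨B₂, fun w hw => Or.inr (Or.inr hw), h2⟩
  obtain ⟨w, hwB, A', hA'A, hA', hAB⟩ := hA.exists_first_hit hB.isCompact.isClosed hx hB.left_mem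
  by_cases hwz : w = z
  · subst hwz
    exact ⟨A', fun v hv => Or.inl (hA'A hv), hA'⟩
  by_cases hwy : w = y
  · subst hwy
    exact ⟨A' ∪ B, Set.union_subset_union_left _ hA'A, hA'.trans hB hAB⟩
  obtain ⟨B₁, B₂, rfl, -, -, h2⟩ := hB.split hwB hwy hwz
  exact ⟨A' ∪ B₂, Set.union_subset_union hA'A Set.subset_union_right,
    hA'.trans h2 fun v hv => hAB ⟨hv.1, Or.inr hv.2⟩⟩

theorem isArc_graph {g : ℝ → ℝ} (hg : Continuous g) {a b : ℝ} (hab : a < b) :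
    IsArc ((fun u => (u, g u)) '' Set.Icc a b) (a, g a) (b, g b) :=
  isArc_image_Icc hab (by fun_prop) fun _ _ _ _ h => congrArg Prod.fst h

theorem isArc_vertical {u a b : ℝ} (hab : a < b) :
    IsArc ((fun v => (u, v)) '' Set.Icc a b) (u, a) (u, b) :=
  isArc_image_Icc hab (by fun_prop) fun _ _ _ _ h => congrArg Prod.snd h

/-! ### Cutting the plane open along an arc -/

theorem exists_log_compl_range {f : I → ℂ} (hf : Continuous f) :
    ∃ L : ℂ → ℂ, ContinuousOn L (Set.range f)ᶜ ∧
      ∀ z ∉ Set.range f, Complex.exp (L z) = (z - f 0) / (z - f 1) := by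
  classical
  have hne : ∀ (t : I) (z : ↥(Set.range f)ᶜ), (z : ℂ) - f t ≠ 0 := fun t z h =>
    z.2 ⟨t, (sub_eq_zero.1 h).symm⟩
  let H : C(I × ↥(Set.range f)ᶜ, {w : ℂ // w ≠ 0}) :=
    ⟨fun x => ⟨((x.2 : ℂ) - f (σ x.1)) / (x.2 - f 1), div_ne_zero (hne _ _) (hne _ _)⟩, by
      refine Continuous.subtype_mk (Continuous.div ?_ ?_ fun x : I × ↥(Set.range f)ᶜ => hne 1 x.2) _
      · exact (continuous_subtype_val.comp continuous_snd).sub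
          (hf.comp (unitInterval.continuous_symm.comp continuous_fst))
      · exact (continuous_subtype_val.comp continuous_snd).sub continuous_const⟩
  have H0 : ∀ a, H (0, a) = ⟨Complex.exp ((0 : C(↥(Set.range f)ᶜ, ℂ)) a), Complex.exp_ne_zero _⟩ :=
    fun a => Subtype.ext (by simp [H, div_self (hne 1 a)])
  let K := Complex.isCoveringMap_exp.liftHomotopy H 0 H0
  have hK : ∀ a, Complex.exp (K (1, a)) = (a - f 0) / (a - f 1) := fun a => by
    have : Complex.exp (K (1, a)) = (H (1, a)).1 := congrArg Subtype.val
      (congrFun (Complex.isCoveringMap_exp.liftHomotopy_lifts H 0 H0) (1, a))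
    rw [this]
    simp [H]
  refine ⟨fun z => if hz : z ∈ (Set.range f)ᶜ then K (1, ⟨z, hz⟩) else 0, ?_, fun z hz => ?_⟩
  · rw [continuousOn_iff_continuous_domRestrict]
    refine (K.continuous.comp (Continuous.prodMk_right 1)).congr fun z => ?_
    simp only [Function.comp, Set.domRestrict_apply]
    rw [dif_pos z.2]
  · simp only [dif_pos (show z ∈ (Set.range f)ᶜ from hz), hK]

theorem ratio_injective {a b c d : ℝ} (hb : 0 < b) (hd : 0 < d) (ha : 0 ≤ a) (hc : 0 ≤ c)
    (h : (a - b) / (a + b) = (c - d) / (c + d)) : a / b = c / d := by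
  rw [div_eq_div_iff (by positivity) (by positivity)] at h ⊢
  nlinarith

/-- The complement of an arc embeds in the region between a segment and a parabola, in such a
way that the ends of the arc go to the two corners. -/
theorem IsArc.exists_lens_map {A : Set (ℝ × ℝ)} {p q : ℝ × ℝ} (h : IsArc A p q) :
    ∃ Φ : ℝ × ℝ → ℝ × ℝ, ContinuousOn Φ (Aᶜ ∪ {p, q}) ∧ Set.InjOn Φ (Aᶜ ∪ {p, q}) ∧
      Φ p = (-1, 0) ∧ Φ q = (1, 0) ∧
      ∀ z ∉ A, 0 < (Φ z).2 ∧ (Φ z).2 < 1 - (Φ z).1 ^ 2 := by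
  have hpA := h.left_mem
  have hqA := h.right_mem
  have hpq := h.ne
  obtain ⟨f, hf, -, h0, h1, hr⟩ := h
  let e : ℝ × ℝ → ℂ := Complex.equivRealProdCLM.symm
  have he : Continuous e := Complex.equivRealProdCLM.symm.continuous
  have hei : Function.Injective e := Complex.equivRealProdCLM.symm.injective
  obtain ⟨L, hL, hexp⟩ := exists_log_compl_range (he.comp hf)
  have hA : ∀ z, z ∉ A → e z ∉ Set.range (e ∘ f) := by
    rintro z hz ⟨t, ht⟩
    exact hz (hr ▸ ⟨t, hei ht⟩)
  simp only [Function.comp, h0, h1] at hexp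
  set u : ℝ × ℝ → ℝ := fun z => (‖e z - e p‖ - ‖e z - e q‖) / (‖e z - e p‖ + ‖e z - e q‖) with hu
  have hpos : ∀ z, 0 < ‖e z - e p‖ + ‖e z - e q‖ := fun z => by
    have : 0 < ‖e p - e q‖ := norm_pos_iff.2 (sub_ne_zero.2 (hei.ne hpq))
    have := norm_sub_le_norm_sub_add_norm_sub (e p) (e z) (e q)
    rw [norm_sub_rev (e p) (e z)] at this
    linarith
  have hnp : ∀ {z w}, z ≠ w → 0 < ‖e z - e w‖ := fun hzw =>
    norm_pos_iff.2 (sub_ne_zero.2 (hei.ne hzw))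
  have huc : Continuous u := by
    refine Continuous.div (by fun_prop) (by fun_prop) fun z => (hpos z).ne'
  have hup : u p = -1 := by
    have := (hnp hpq).ne'
    simp only [hu, sub_self, norm_zero, zero_sub, zero_add]
    field_simp
  have huq : u q = 1 := by
    have := (hnp hpq.symm).ne'
    simp only [hu, sub_self, norm_zero, sub_zero, add_zero]
    field_simp
  have hu1 : ∀ z, z ∉ A → -1 < u z ∧ u z < 1 := fun z hz => by
    have hzp := hnp (ne_of_mem_of_not_mem hpA hz).symm
    have hzq := hnp (ne_of_mem_of_not_mem hqA hz).symm
    constructor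
    · rw [hu, lt_div_iff₀ (hpos z)]; linarith
    · rw [hu, div_lt_iff₀ (hpos z)]; linarith
  have hule : ∀ z, 0 ≤ 1 - u z ^ 2 := fun z => by
    have : |u z| ≤ 1 := by
      rw [hu, abs_div, abs_of_pos (hpos z), div_le_one (hpos z), abs_le]
      constructor <;> linarith [norm_nonneg (e z - e p), norm_nonneg (e z - e q)]
    nlinarith [abs_le.1 this]
  set s : ℝ → ℝ := fun y => Real.sigmoid y with hs
  have hs0 : ∀ y, 0 < s y := fun y => Real.sigmoid_pos y
  have hs1 : ∀ y, s y < 1 := fun y => Real.sigmoid_lt_one y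
  set v : ℝ × ℝ → ℝ := fun z => s (L (e z)).im * (1 - u z ^ 2) with hv
  have hvA : ∀ z, z ∉ A → 0 < v z ∧ v z < 1 - u z ^ 2 := fun z hz => by
    have : 0 < 1 - u z ^ 2 := by nlinarith [hu1 z hz]
    exact ⟨mul_pos (hs0 _) this, by nlinarith [hs1 (L (e z)).im]⟩
  have hvc : ∀ z, u z ^ 2 = 1 → ContinuousAt v z := fun z hz => by
    have hz0 : v z = 0 := by simp [hv, hz]
    rw [ContinuousAt, hz0]
    refine squeeze_zero (g := fun w => 1 - u w ^ 2)
      (fun w => mul_nonneg (hs0 _).le (hule w))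
      (fun w => mul_le_of_le_one_left (hule w) (hs1 _).le) ?_
    have : Continuous fun w => 1 - u w ^ 2 := by fun_prop
    simpa [hz] using this.tendsto z
  have hAo : IsOpen Aᶜ := by
    rw [← hr]
    exact (isCompact_range hf).isClosed.isOpen_compl
  refine ⟨fun z => (u z, v z), ?_, ?_, ?_, ?_, hvA⟩
  · refine huc.continuousOn.prodMk fun z hz => ?_
    rcases hz with hz | rfl | rfl
    · refine ContinuousAt.continuousWithinAt ?_
      have hLz : ContinuousAt (fun w => L (e w)) z :=
        ((hL.comp he.continuousOn hA : ContinuousOn (L ∘ e) Aᶜ)).continuousAt (hAo.mem_nhds hz)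
      have : ContinuousAt (fun w => s (L (e w)).im) z :=
        (Real.hasDerivAt_sigmoid _).continuousAt.comp
          (Complex.continuous_im.continuousAt.comp hLz)
      exact this.mul (by fun_prop)
    · exact (hvc _ (by rw [hup]; norm_num)).continuousWithinAt
    · exact (hvc _ (by rw [huq]; norm_num)).continuousWithinAt
  · have inA : ∀ z ∉ A, ∀ w ∉ A, u z = u w → v z = v w → z = w := by
      intro z hz w hw h1 h2
      have hzq := hnp (ne_of_mem_of_not_mem hqA hz).symm
      have hwq := hnp (ne_of_mem_of_not_mem hqA hw).symm
      have hn := ratio_injective hzq hwq (norm_nonneg _) (norm_nonneg _) h1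
      have him : (L (e z)).im = (L (e w)).im := by
        have : 1 - u w ^ 2 ≠ 0 := by nlinarith [hu1 w hw]
        simp only [hv, h1] at h2
        exact Real.sigmoid_injective (mul_right_cancel₀ this h2)
      have hre : (L (e z)).re = (L (e w)).re := by
        have a1 := congrArg norm (hexp _ (hA z hz))
        have a2 := congrArg norm (hexp _ (hA w hw))
        rw [Complex.norm_exp, norm_div] at a1 a2
        rw [← a1, ← a2] at hn
        exact Real.exp_injective hn
      have hq : (e z - e p) / (e z - e q) = (e w - e p) / (e w - e q) := by
        rw [← hexp _ (hA z hz), ← hexp _ (hA w hw), Complex.ext hre him]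
      rw [div_eq_div_iff (norm_pos_iff.1 hzq) (norm_pos_iff.1 hwq)] at hq
      have : (e z - e w) * (e p - e q) = 0 := by linear_combination hq
      rcases mul_eq_zero.1 this with h | h
      · exact hei (sub_eq_zero.1 h)
      · exact absurd (hei (sub_eq_zero.1 h)) hpq
    rintro z hz w hw hzw
    obtain ⟨h1, h2⟩ := Prod.mk.inj hzw
    rcases hz with hz | rfl | rfl <;> rcases hw with hw | rfl | rfl
    · exact inA z hz w hw h1 h2
    · linarith [hu1 z hz]
    · linarith [hu1 z hz]
    · linarith [hu1 w hw]
    · rfl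
    · linarith
    · linarith [hu1 w hw]
    · linarith
    · rfl
  · simp [hv, hup]
  · simp [hv, huq]

/-! ### Operations on drawings -/

/-- The drawing is 1-planar and all its crossings satisfy the relation `R`. -/
def Drawing.Obeys {G : SimpleGraph V} (D : Drawing G) (R : V → V → V → V → Prop) : Prop :=
  D.IsOnePlanar ∧ ∀ a b c d : V, ∀ p : ℝ × ℝ, D.Crosses s(a, b) s(c, d) p → R a b c d

section

variable {G : SimpleGraph V} {K : SimpleGraph W}

theorem Drawing.pos_mem_image (D : Drawing G) (v : V) : D.pos v ∈ D.image :=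
  Or.inl ⟨v, rfl⟩

theorem Drawing.arc_subset_image (D : Drawing G) {e : Sym2 V} (he : e ∈ G.edgeSet) :
    D.arc e ⊆ D.image := fun _ hz =>
  Or.inr (Set.mem_biUnion he hz)

theorem Drawing.mem_image_iff (D : Drawing G) {z : ℝ × ℝ} :
    z ∈ D.image ↔ (∃ v, D.pos v = z) ∨ ∃ e ∈ G.edgeSet, z ∈ D.arc e := by
  simp [Drawing.image]

theorem Drawing.Crosses.symm {D : Drawing G} {e e' : Sym2 V} {p : ℝ × ℝ}
    (h : D.Crosses e e' p) : D.Crosses e' e p :=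
  ⟨h.2.1, h.1, h.2.2.1.symm, h.2.2.2.2.1, h.2.2.2.1, h.2.2.2.2.2⟩

theorem Drawing.mem_of_mem_arc_inter (D : Drawing G) {e e' : Sym2 V} (he : e ∈ G.edgeSet)
    (he' : e' ∈ G.edgeSet) (hne : e ≠ e') {z : ℝ × ℝ} (hz : z ∈ D.arc e) (hz' : z ∈ D.arc e') :
    (∃ v, D.pos v = z ∧ v ∈ e ∧ v ∈ e') ∨ D.Crosses e e' z := by
  by_cases h : z ∈ Set.range D.pos
  · obtain ⟨v, rfl⟩ := h
    exact Or.inl ⟨v, rfl, D.arc_avoid e he v hz, D.arc_avoid e' he' v hz'⟩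
  · exact Or.inr ⟨he, he', hne, hz, hz', h⟩

theorem Drawing.isCompact_image [Finite V] (D : Drawing G) : IsCompact D.image := by
  refine (Set.finite_range D.pos).isCompact.union
    ((Set.toFinite G.edgeSet).isCompact_biUnion fun e he => ?_)
  induction e with
  | h u v => exact (D.arc_curve _ he u v rfl).isCompact

/-- The image of a drawing under an embedding of (a neighbourhood of) its point set. -/
def Drawing.map (D : Drawing G) (Φ : ℝ × ℝ → ℝ × ℝ) (hc : ContinuousOn Φ D.image)
    (hi : Set.InjOn Φ D.image) : Drawing G where
  pos v := Φ (D.pos v)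
  pos_inj u v h := D.pos_inj (hi (D.pos_mem_image u) (D.pos_mem_image v) h)
  arc e := Φ '' D.arc e
  arc_curve e he u v h := (D.arc_curve e he u v h).image
    (hc.mono (D.arc_subset_image he)) (hi.mono (D.arc_subset_image he))
  arc_avoid e he w := by
    rintro ⟨z, hz, h⟩
    rw [hi (D.arc_subset_image he hz) (D.pos_mem_image w) h] at hz
    exact D.arc_avoid e he w hz
  arc_finite_inter e he e' he' hne := by
    rw [← hi.image_inter (D.arc_subset_image he) (D.arc_subset_image he')]
    exact (D.arc_finite_inter e he e' he' hne).image Φ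

theorem Drawing.image_map (D : Drawing G) (Φ : ℝ × ℝ → ℝ × ℝ) (hc : ContinuousOn Φ D.image)
    (hi : Set.InjOn Φ D.image) : (D.map Φ hc hi).image = Φ '' D.image := by
  simp only [Drawing.image, Set.image_union, Set.image_iUnion, ← Set.range_comp]
  rfl

theorem Drawing.Crosses.of_map {D : Drawing G} {Φ : ℝ × ℝ → ℝ × ℝ} {hc : ContinuousOn Φ D.image}
    {hi : Set.InjOn Φ D.image} {e e' : Sym2 V} {p : ℝ × ℝ} (h : (D.map Φ hc hi).Crosses e e' p) :
    ∃ q, Φ q = p ∧ D.Crosses e e' q := by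
  obtain ⟨he, he', hne, ⟨q, hq, rfl⟩, ⟨q', hq', h⟩, hp⟩ := h
  rw [hi (D.arc_subset_image he' hq') (D.arc_subset_image he hq) h] at hq'
  exact ⟨q, rfl, he, he', hne, hq, hq', fun ⟨v, hv⟩ => hp ⟨v, congrArg Φ hv⟩⟩

theorem Drawing.Obeys.map {D : Drawing G} {R : V → V → V → V → Prop} (h : D.Obeys R)
    (Φ : ℝ × ℝ → ℝ × ℝ) (hc : ContinuousOn Φ D.image) (hi : Set.InjOn Φ D.image) :
    (D.map Φ hc hi).Obeys R := by
  refine ⟨⟨?_, ?_⟩, ?_⟩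
  · intro e e₁ e₂ p q h1 h2
    obtain ⟨p', rfl, c1⟩ := h1.of_map
    obtain ⟨q', rfl, c2⟩ := h2.of_map
    obtain ⟨rfl, rfl⟩ := h.1.1 _ _ _ _ _ c1 c2
    exact ⟨rfl, rfl⟩
  · intro e e' p h1
    obtain ⟨p', rfl, c1⟩ := h1.of_map
    exact h.1.2 _ _ _ c1
  · intro a b c d p h1
    obtain ⟨p', rfl, c1⟩ := h1.of_map
    exact h.2 _ _ _ _ _ c1

theorem exists_mk_of_map_eq {ι : W → V} {f : Sym2 W} {a b : V} (h : s(a, b) = f.map ι) :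
    ∃ x y, f = s(x, y) ∧ ι x = a ∧ ι y = b := by
  induction f with
  | h x y =>
    rw [Sym2.map_mk, Sym2.eq_iff] at h
    rcases h with ⟨rfl, rfl⟩ | ⟨rfl, rfl⟩
    · exact ⟨x, y, rfl, rfl, rfl⟩
    · exact ⟨y, x, Sym2.eq_swap, rfl, rfl⟩

theorem Drawing.isArc_of_map_eq (D : Drawing K) {ι : W → V} {pos : V → ℝ × ℝ}
    (hp : ∀ x, pos (ι x) = D.pos x) {f : Sym2 W} (hf : f ∈ K.edgeSet) {u v : V}
    (h : f.map ι = s(u, v)) : IsArc (D.arc f) (pos u) (pos v) := by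
  obtain ⟨x, y, rfl, rfl, rfl⟩ := exists_mk_of_map_eq h.symm
  rw [hp, hp]
  exact D.arc_curve _ hf _ _ rfl

theorem map_mem_edgeSet {ι : W → V} (hK : ∀ x y, K.Adj x y → G.Adj (ι x) (ι y)) {e : Sym2 W}
    (he : e ∈ K.edgeSet) : e.map ι ∈ G.edgeSet := by
  induction e with
  | h u v => exact hK u v he

/-- The drawing of a subgraph induced by a drawing. -/
def Drawing.restrict (D : Drawing G) {ι : W → V} (hι : Function.Injective ι)
    (hK : ∀ x y, K.Adj x y → G.Adj (ι x) (ι y)) : Drawing K where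
  pos x := D.pos (ι x)
  pos_inj := D.pos_inj.comp hι
  arc e := D.arc (e.map ι)
  arc_curve e he u v h := D.arc_curve _ (map_mem_edgeSet hK he) _ _ (by rw [h, Sym2.map_mk])
  arc_avoid e he w hw := by
    obtain ⟨x, hx, h⟩ := Sym2.mem_map.1 (D.arc_avoid _ (map_mem_edgeSet hK he) _ hw)
    exact hι h ▸ hx
  arc_finite_inter e he e' he' hne := D.arc_finite_inter _ (map_mem_edgeSet hK he) _
    (map_mem_edgeSet hK he') ((Sym2.map.injective hι).ne hne)

theorem Drawing.Crosses.of_restrict {D : Drawing G} {ι : W → V} {hι : Function.Injective ι}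
    {hK : ∀ x y, K.Adj x y → G.Adj (ι x) (ι y)} {e e' : Sym2 W} {p : ℝ × ℝ}
    (h : (D.restrict hι hK).Crosses e e' p) : D.Crosses (e.map ι) (e'.map ι) p := by
  obtain ⟨he, he', hne, hp, hp', hv⟩ := h
  refine ⟨map_mem_edgeSet hK he, map_mem_edgeSet hK he', (Sym2.map.injective hι).ne hne,
    hp, hp', ?_⟩
  rintro ⟨v, rfl⟩
  obtain ⟨x, -, rfl⟩ := Sym2.mem_map.1 (D.arc_avoid _ (map_mem_edgeSet hK he) _ hp)
  exact hv ⟨x, rfl⟩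

theorem Drawing.Obeys.restrict {D : Drawing G} {R : V → V → V → V → Prop} (h : D.Obeys R)
    {ι : W → V} (hι : Function.Injective ι) (hK : ∀ x y, K.Adj x y → G.Adj (ι x) (ι y)) :
    (D.restrict hι hK).Obeys fun a b c d => R (ι a) (ι b) (ι c) (ι d) := by
  refine ⟨⟨?_, ?_⟩, ?_⟩
  · intro e e₁ e₂ p q h1 h2
    obtain ⟨h3, rfl⟩ := h.1.1 _ _ _ _ _ h1.of_restrict h2.of_restrict
    exact ⟨Sym2.map.injective hι h3, rfl⟩
  · intro e e' p h1 v hv hv'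
    exact h.1.2 _ _ _ h1.of_restrict (ι v) (Sym2.mem_map.2 ⟨v, hv, rfl⟩)
      (Sym2.mem_map.2 ⟨v, hv', rfl⟩)
  · intro a b c d p h1
    exact h.2 _ _ _ _ p h1.of_restrict

end

/-! ### Gluing two drawings -/

section

variable {W₁ W₂ : Type*} {G : SimpleGraph V} {K₁ : SimpleGraph W₁} {K₂ : SimpleGraph W₂}

/-- The edge `e` is drawn in `D` as a copy of an edge in `D₁`. -/
def Drawing.CopiedFrom (D : Drawing G) (ι₁ : W₁ → V) (D₁ : Drawing K₁) (e : Sym2 V) : Prop :=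
  ∃ e₁ ∈ K₁.edgeSet, e = e₁.map ι₁ ∧ D.arc e = D₁.arc e₁

theorem Drawing.Crosses.of_copiedFrom {D : Drawing G} {ι₁ : W₁ → V} {D₁ : Drawing K₁}
    {ι₂ : W₂ → V} {D₂ : Drawing K₂} (h1 : ∀ x, D.pos (ι₁ x) = D₁.pos x)
    (hmeet : ∀ z ∈ D₁.image ∩ D₂.image, z ∈ Set.range D.pos)
    (hD : ∀ e ∈ G.edgeSet, D.CopiedFrom ι₁ D₁ e ∨ D.CopiedFrom ι₂ D₂ e)
    {e₁ : Sym2 W₁} (he₁ : e₁ ∈ K₁.edgeSet) (harc : D.arc (e₁.map ι₁) = D₁.arc e₁)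
    {e' : Sym2 V} {p : ℝ × ℝ} (h : D.Crosses (e₁.map ι₁) e' p) :
    ∃ e₁', e' = e₁'.map ι₁ ∧ D₁.Crosses e₁ e₁' p := by
  obtain ⟨-, he', hne, hp, hp', hv⟩ := h
  rw [harc] at hp
  rcases hD e' he' with ⟨e₁', h3, rfl, h4⟩ | ⟨e₂', h3, rfl, h4⟩ <;> rw [h4] at hp'
  · exact ⟨e₁', rfl, he₁, h3, fun h => hne (h ▸ rfl), hp, hp',
      fun ⟨x, hx⟩ => hv ⟨ι₁ x, by rw [h1, hx]⟩⟩
  · exact absurd (hmeet p ⟨D₁.arc_subset_image he₁ hp, D₂.arc_subset_image h3 hp'⟩) hv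

theorem Drawing.obeys_of_copiedFrom {D : Drawing G} {ι₁ : W₁ → V} {D₁ : Drawing K₁}
    {ι₂ : W₂ → V} {D₂ : Drawing K₂} (hι₁ : Function.Injective ι₁) (hι₂ : Function.Injective ι₂)
    (h1 : ∀ x, D.pos (ι₁ x) = D₁.pos x) (h2 : ∀ x, D.pos (ι₂ x) = D₂.pos x)
    (hmeet : ∀ z ∈ D₁.image ∩ D₂.image, z ∈ Set.range D.pos)
    (hD : ∀ e ∈ G.edgeSet, D.CopiedFrom ι₁ D₁ e ∨ D.CopiedFrom ι₂ D₂ e)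
    {R : V → V → V → V → Prop}
    (hR₁ : D₁.Obeys fun a b c d => R (ι₁ a) (ι₁ b) (ι₁ c) (ι₁ d))
    (hR₂ : D₂.Obeys fun a b c d => R (ι₂ a) (ι₂ b) (ι₂ c) (ι₂ d)) : D.Obeys R := by
  have hmeet' : ∀ z ∈ D₂.image ∩ D₁.image, z ∈ Set.range D.pos := fun z hz => hmeet z hz.symm
  have hD' := fun e he => (hD e he).symm
  refine ⟨⟨?_, ?_⟩, ?_⟩
  · intro e e₁ e₂ p q hp hq
    rcases hD e hp.1 with ⟨f, hf, rfl, hfa⟩ | ⟨f, hf, rfl, hfa⟩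
    · obtain ⟨f₁, rfl, c1⟩ := hp.of_copiedFrom h1 hmeet hD hf hfa
      obtain ⟨f₂, rfl, c2⟩ := hq.of_copiedFrom h1 hmeet hD hf hfa
      obtain ⟨rfl, rfl⟩ := hR₁.1.1 _ _ _ _ _ c1 c2
      exact ⟨rfl, rfl⟩
    · obtain ⟨f₁, rfl, c1⟩ := hp.of_copiedFrom h2 hmeet' hD' hf hfa
      obtain ⟨f₂, rfl, c2⟩ := hq.of_copiedFrom h2 hmeet' hD' hf hfa
      obtain ⟨rfl, rfl⟩ := hR₂.1.1 _ _ _ _ _ c1 c2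
      exact ⟨rfl, rfl⟩
  · intro e e' p hp v hv hv'
    rcases hD e hp.1 with ⟨f, hf, rfl, hfa⟩ | ⟨f, hf, rfl, hfa⟩
    · obtain ⟨f₁, rfl, c1⟩ := hp.of_copiedFrom h1 hmeet hD hf hfa
      obtain ⟨x, hx, rfl⟩ := Sym2.mem_map.1 hv
      obtain ⟨y, hy, hxy⟩ := Sym2.mem_map.1 hv'
      exact hR₁.1.2 _ _ _ c1 x hx (hι₁ hxy ▸ hy)
    · obtain ⟨f₁, rfl, c1⟩ := hp.of_copiedFrom h2 hmeet' hD' hf hfa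
      obtain ⟨x, hx, rfl⟩ := Sym2.mem_map.1 hv
      obtain ⟨y, hy, hxy⟩ := Sym2.mem_map.1 hv'
      exact hR₂.1.2 _ _ _ c1 x hx (hι₂ hxy ▸ hy)
  · intro a b c d p hp
    rcases hD _ hp.1 with ⟨f, hf, hab, hfa⟩ | ⟨f, hf, hab, hfa⟩ <;> rw [hab] at hp hfa
    · obtain ⟨f₁, hcd, c1⟩ := hp.of_copiedFrom h1 hmeet hD hf hfa
      obtain ⟨x, y, rfl, rfl, rfl⟩ := exists_mk_of_map_eq hab
      obtain ⟨z, w, rfl, rfl, rfl⟩ := exists_mk_of_map_eq hcd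
      exact hR₁.2 _ _ _ _ _ c1
    · obtain ⟨f₁, hcd, c1⟩ := hp.of_copiedFrom h2 hmeet' hD' hf hfa
      obtain ⟨x, y, rfl, rfl, rfl⟩ := exists_mk_of_map_eq hab
      obtain ⟨z, w, rfl, rfl, rfl⟩ := exists_mk_of_map_eq hcd
      exact hR₂.2 _ _ _ _ _ c1

open Classical in
/-- Two drawings which meet only in common vertices form a drawing of the union. -/
theorem Drawing.exists_glue {ι₁ : W₁ → V} {ι₂ : W₂ → V} (hι₁ : Function.Injective ι₁)
    (hι₂ : Function.Injective ι₂) (hcov : ∀ v, v ∈ Set.range ι₁ ∨ v ∈ Set.range ι₂)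
    (D₁ : Drawing K₁) (D₂ : Drawing K₂)
    (hagree : ∀ x y, ι₁ x = ι₂ y → D₁.pos x = D₂.pos y)
    (hmeet : ∀ z ∈ D₁.image ∩ D₂.image, ∃ x y, ι₁ x = ι₂ y ∧ D₁.pos x = z ∧ D₂.pos y = z)
    (hG : ∀ v w, G.Adj v w → (∃ x y, K₁.Adj x y ∧ ι₁ x = v ∧ ι₁ y = w) ∨
      ∃ x y, K₂.Adj x y ∧ ι₂ x = v ∧ ι₂ y = w)
    {R : V → V → V → V → Prop}
    (hR₁ : D₁.Obeys fun a b c d => R (ι₁ a) (ι₁ b) (ι₁ c) (ι₁ d))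
    (hR₂ : D₂.Obeys fun a b c d => R (ι₂ a) (ι₂ b) (ι₂ c) (ι₂ d)) :
    ∃ D : Drawing G, D.Obeys R ∧ (∀ x, D.pos (ι₁ x) = D₁.pos x) ∧
      (∀ y, D.pos (ι₂ y) = D₂.pos y) ∧ D.image ⊆ D₁.image ∪ D₂.image := by
  set pos : V → ℝ × ℝ := fun v => if h : ∃ x, ι₁ x = v then D₁.pos h.choose else
    if h : ∃ y, ι₂ y = v then D₂.pos h.choose else 0 with hpos
  have h1 : ∀ x, pos (ι₁ x) = D₁.pos x := fun x => by
    have h : ∃ y, ι₁ y = ι₁ x := ⟨x, rfl⟩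
    simp only [hpos, dif_pos h, hι₁ h.choose_spec]
  have h2 : ∀ y, pos (ι₂ y) = D₂.pos y := fun y => by
    by_cases h : ∃ x, ι₁ x = ι₂ y
    · simp only [hpos, dif_pos h]
      exact hagree _ _ h.choose_spec
    · have h' : ∃ x, ι₂ x = ι₂ y := ⟨y, rfl⟩
      simp only [hpos, dif_neg h, dif_pos h', hι₂ h'.choose_spec]
  set arc : Sym2 V → Set (ℝ × ℝ) := fun e =>
    if h : ∃ f, f ∈ K₁.edgeSet ∧ e = f.map ι₁ then D₁.arc h.choose else
    if h : ∃ f, f ∈ K₂.edgeSet ∧ e = f.map ι₂ then D₂.arc h.choose else ∅ with harc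
  have hE : ∀ e ∈ G.edgeSet, (∃ f ∈ K₁.edgeSet, e = f.map ι₁ ∧ arc e = D₁.arc f) ∨
      ∃ f ∈ K₂.edgeSet, e = f.map ι₂ ∧ arc e = D₂.arc f := by
    intro e he
    by_cases h : ∃ f, f ∈ K₁.edgeSet ∧ e = f.map ι₁
    · exact Or.inl ⟨_, h.choose_spec.1, h.choose_spec.2, by simp only [harc, dif_pos h]⟩
    · have h' : ∃ f, f ∈ K₂.edgeSet ∧ e = f.map ι₂ := by
        induction e with
        | h u v =>
          rcases hG u v he with ⟨x, y, hxy, rfl, rfl⟩ | ⟨x, y, hxy, rfl, rfl⟩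
          · exact absurd ⟨s(x, y), hxy, rfl⟩ h
          · exact ⟨s(x, y), hxy, rfl⟩
      exact Or.inr ⟨_, h'.choose_spec.1, h'.choose_spec.2,
        by simp only [harc, dif_neg h, dif_pos h']⟩
  have hv1 : ∀ v, pos v ∈ D₁.image → ∃ x, ι₁ x = v := by
    intro v hv
    rcases hcov v with h | ⟨y, rfl⟩
    · exact h
    rw [h2] at hv
    obtain ⟨x', y', h, -, h'⟩ := hmeet _ ⟨hv, D₂.pos_mem_image y⟩
    exact ⟨x', h.trans (congrArg ι₂ (D₂.pos_inj h'))⟩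
  have hv2 : ∀ v, pos v ∈ D₂.image → ∃ y, ι₂ y = v := by
    intro v hv
    rcases hcov v with ⟨x, rfl⟩ | h
    · rw [h1] at hv
      obtain ⟨x', y', h, h', -⟩ := hmeet _ ⟨D₁.pos_mem_image x, hv⟩
      exact ⟨y', h.symm.trans (congrArg ι₁ (D₁.pos_inj h'))⟩
    · exact h
  have hfin : ∀ f₁ ∈ K₁.edgeSet, ∀ f₂ ∈ K₂.edgeSet, (D₁.arc f₁ ∩ D₂.arc f₂).Finite := by
    intro f₁ hf₁ f₂ hf₂
    have hf : {x | x ∈ f₁}.Finite := by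
      induction f₁ with
      | h a b => exact (Set.toFinite {a, b}).subset fun x hx => Sym2.mem_iff.1 hx
    refine (hf.image D₁.pos).subset fun z hz => ?_
    obtain ⟨x, y, -, rfl, -⟩ :=
      hmeet z ⟨D₁.arc_subset_image hf₁ hz.1, D₂.arc_subset_image hf₂ hz.2⟩
    exact ⟨x, D₁.arc_avoid _ hf₁ _ hz.1, rfl⟩
  let D : Drawing G :=
    { pos := pos
      pos_inj := by
        intro u v h
        rcases hcov u with ⟨x, rfl⟩ | ⟨x, rfl⟩
        · obtain ⟨y, rfl⟩ := hv1 v (by rw [← h, h1]; exact D₁.pos_mem_image x)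
          rw [h1, h1] at h
          rw [D₁.pos_inj h]
        · obtain ⟨y, rfl⟩ := hv2 v (by rw [← h, h2]; exact D₂.pos_mem_image x)
          rw [h2, h2] at h
          rw [D₂.pos_inj h]
      arc := arc
      arc_curve := by
        intro e he u v h
        rcases hE e he with ⟨f, hf, rfl, ha⟩ | ⟨f, hf, rfl, ha⟩ <;> rw [ha]
        · exact D₁.isArc_of_map_eq h1 hf h
        · exact D₂.isArc_of_map_eq h2 hf h
      arc_avoid := by
        intro e he w hw
        rcases hE e he with ⟨f, hf, rfl, ha⟩ | ⟨f, hf, rfl, ha⟩ <;> rw [ha] at hw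
        · obtain ⟨x, rfl⟩ := hv1 w (D₁.arc_subset_image hf hw)
          rw [h1] at hw
          exact Sym2.mem_map.2 ⟨x, D₁.arc_avoid _ hf _ hw, rfl⟩
        · obtain ⟨x, rfl⟩ := hv2 w (D₂.arc_subset_image hf hw)
          rw [h2] at hw
          exact Sym2.mem_map.2 ⟨x, D₂.arc_avoid _ hf _ hw, rfl⟩
      arc_finite_inter := by
        intro e he e' he' hne
        rcases hE e he with ⟨f, hf, rfl, ha⟩ | ⟨f, hf, rfl, ha⟩ <;>
          rcases hE e' he' with ⟨f', hf', rfl, ha'⟩ | ⟨f', hf', rfl, ha'⟩ <;> rw [ha, ha']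
        · exact D₁.arc_finite_inter _ hf _ hf' fun h => hne (h ▸ rfl)
        · exact hfin _ hf _ hf'
        · rw [Set.inter_comm]
          exact hfin _ hf' _ hf
        · exact D₂.arc_finite_inter _ hf _ hf' fun h => hne (h ▸ rfl) }
  refine ⟨D, Drawing.obeys_of_copiedFrom hι₁ hι₂ h1 h2 ?_ hE hR₁ hR₂, h1, h2, ?_⟩
  · intro z hz
    obtain ⟨x, y, -, rfl, -⟩ := hmeet z hz
    exact ⟨ι₁ x, h1 x⟩
  · intro z hz
    rcases D.mem_image_iff.1 hz with ⟨v, rfl⟩ | ⟨e, he, hz⟩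
    · rcases hcov v with ⟨x, rfl⟩ | ⟨x, rfl⟩
      · exact Or.inl (by rw [show D.pos (ι₁ x) = _ from h1 x]; exact D₁.pos_mem_image x)
      · exact Or.inr (by rw [show D.pos (ι₂ x) = _ from h2 x]; exact D₂.pos_mem_image x)
    · rcases hE e he with ⟨f, hf, rfl, ha⟩ | ⟨f, hf, rfl, ha⟩ <;>
        rw [show D.arc _ = _ from ha] at hz
      · exact Or.inl (D₁.arc_subset_image hf hz)
      · exact Or.inr (D₂.arc_subset_image hf hz)

end

/-! ### Adding an edge along an arc -/

theorem bool_edge_mem : ∀ e ∈ (⊤ : SimpleGraph Bool).edgeSet, ∀ w, w ∈ e := by decide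

theorem bool_edge_eq : ∀ e ∈ (⊤ : SimpleGraph Bool).edgeSet,
    ∀ e' ∈ (⊤ : SimpleGraph Bool).edgeSet, e = e' := by decide

/-- The drawing of a single edge along an arc. -/
def IsArc.drawing {A : Set (ℝ × ℝ)} {p q : ℝ × ℝ} (h : IsArc A p q) :
    Drawing (⊤ : SimpleGraph Bool) where
  pos b := if b then q else p
  pos_inj := by
    rintro (_ | _) (_ | _) hb
    · rfl
    · exact absurd hb (by simpa using h.ne)
    · exact absurd hb (by simpa using h.ne.symm)
    · rfl
  arc _ := A
  arc_curve := by
    rintro e he (_ | _) (_ | _) rfl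
    · exact absurd he (by simp)
    · exact h
    · exact h.symm
    · exact absurd he (by simp)
  arc_avoid _ he w _ := bool_edge_mem _ he w
  arc_finite_inter e he e' he' hne := absurd (bool_edge_eq e he e' he') hne

theorem IsArc.image_drawing {A : Set (ℝ × ℝ)} {p q : ℝ × ℝ} (h : IsArc A p q) :
    h.drawing.image = A := by
  ext z
  rw [Drawing.mem_image_iff]
  constructor
  · rintro (⟨_ | _, rfl⟩ | ⟨e, -, hz⟩)
    · exact h.left_mem
    · exact h.right_mem
    · exact hz
  · exact fun hz => Or.inr ⟨s(false, true), by simp, hz⟩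

theorem IsArc.obeys_drawing {A : Set (ℝ × ℝ)} {p q : ℝ × ℝ} (h : IsArc A p q)
    (R : Bool → Bool → Bool → Bool → Prop) : h.drawing.Obeys R := by
  have hn : ∀ e e' r, ¬ h.drawing.Crosses e e' r := fun e e' r hc =>
    hc.2.2.1 (bool_edge_eq e hc.1 e' hc.2.1)
  exact ⟨⟨fun _ _ _ _ _ hc => absurd hc (hn _ _ _), fun _ _ _ hc => absurd hc (hn _ _ _)⟩,
    fun _ _ _ _ _ hc => absurd hc (hn _ _ _)⟩

/-- An edge can be added to a drawing along an arc which is otherwise disjoint from it. -/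
theorem Drawing.exists_add_arc {G K : SimpleGraph V} (D : Drawing K)
    {R : V → V → V → V → Prop} (hR : D.Obeys R) {x y : V} {A : Set (ℝ × ℝ)}
    (hA : IsArc A (D.pos x) (D.pos y)) (hmeet : A ∩ D.image ⊆ {D.pos x, D.pos y})
    (hG : ∀ v w, G.Adj v w → K.Adj v w ∨ s(v, w) = s(x, y)) :
    ∃ D' : Drawing G, D'.Obeys R ∧ (∀ v, D'.pos v = D.pos v) ∧ D'.image ⊆ D.image ∪ A := by
  have hxy : x ≠ y := fun h => hA.ne (congrArg D.pos h)
  obtain ⟨D', h1, h2, -, h3⟩ := Drawing.exists_glue (G := G) (ι₁ := id)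
    (ι₂ := fun b : Bool => if b then y else x) Function.injective_id (by
        rintro (_ | _) (_ | _) hb <;> simp_all) (fun v => Or.inl ⟨v, rfl⟩)
    D hA.drawing (by
        rintro v (_ | _) hb <;> simp_all [IsArc.drawing]) (by
        rintro z ⟨hz, hz'⟩
        rw [hA.image_drawing] at hz'
        rcases hmeet ⟨hz', hz⟩ with rfl | rfl
        · exact ⟨x, false, by simp, rfl, by simp [IsArc.drawing]⟩
        · exact ⟨y, true, by simp, rfl, by simp [IsArc.drawing]⟩) (by
        intro v w hvw
        rcases hG v w hvw with h | h
        · exact Or.inl ⟨v, w, h, rfl, rfl⟩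
        · rcases Sym2.eq_iff.1 h with ⟨rfl, rfl⟩ | ⟨rfl, rfl⟩
          · exact Or.inr ⟨false, true, by simp, by simp, by simp⟩
          · exact Or.inr ⟨true, false, by simp, by simp, by simp⟩) hR (hA.obeys_drawing _)
  exact ⟨D', h1, h2, by rwa [hA.image_drawing] at h3⟩

/-! ### Drawings with a free arc between two vertices -/

/-- There is a drawing of `K` obeying `R` in which the vertices `x` and `y` can be joined by an
arc that is otherwise disjoint from the drawing. -/
def HasFreeDrawing (K : SimpleGraph W) (R : W → W → W → W → Prop) (x y : W) : Prop :=
  ∃ D : Drawing K, D.Obeys R ∧ ∃ A, IsArc A (D.pos x) (D.pos y) ∧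
    A ∩ D.image ⊆ {D.pos x, D.pos y}

theorem HasFreeDrawing.symm {K : SimpleGraph W} {R : W → W → W → W → Prop} {x y : W}
    (h : HasFreeDrawing K R x y) : HasFreeDrawing K R y x := by
  obtain ⟨D, hD, A, hA, hAD⟩ := h
  exact ⟨D, hD, A, hA.symm, by rwa [Set.pair_comm]⟩

theorem HasFreeDrawing.exists_upper {K : SimpleGraph W} {R : W → W → W → W → Prop} {x y : W}
    (h : HasFreeDrawing K R x y) : ∃ D : Drawing K, D.Obeys R ∧ D.pos x = (-1, 0) ∧
      D.pos y = (1, 0) ∧ ∀ z ∈ D.image, 0 < z.2 ∨ z = (-1, 0) ∨ z = (1, 0) := by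
  obtain ⟨D, hD, A, hA, hAD⟩ := h
  obtain ⟨Φ, hc, hi, hx, hy, hΦ⟩ := hA.exists_lens_map
  have hsub : D.image ⊆ Aᶜ ∪ {D.pos x, D.pos y} := fun z hz => by
    by_cases hzA : z ∈ A
    · exact Or.inr (hAD ⟨hzA, hz⟩)
    · exact Or.inl hzA
  refine ⟨D.map Φ (hc.mono hsub) (hi.mono hsub), hD.map _ _ _, hx, hy, ?_⟩
  rw [Drawing.image_map]
  rintro _ ⟨z, hz, rfl⟩
  rcases hsub hz with h | rfl | rfl
  · exact Or.inl (hΦ z h).1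
  · exact Or.inr (Or.inl hx)
  · exact Or.inr (Or.inr hy)

theorem HasFreeDrawing.exists_lower {K : SimpleGraph W} {R : W → W → W → W → Prop} {x y : W}
    (h : HasFreeDrawing K R x y) : ∃ D : Drawing K, D.Obeys R ∧ D.pos x = (-1, 0) ∧
      D.pos y = (1, 0) ∧ ∀ z ∈ D.image, z.2 < 0 ∨ z = (-1, 0) ∨ z = (1, 0) := by
  obtain ⟨D, hD, hx, hy, himg⟩ := h.exists_upper
  have hi : Function.Injective fun z : ℝ × ℝ => (z.1, -z.2) := fun z w hzw => by
    simpa [Prod.ext_iff] using hzw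
  refine ⟨D.map (fun z => (z.1, -z.2)) (by fun_prop) hi.injOn, hD.map _ _ _,
    by simp [Drawing.map, hx], by simp [Drawing.map, hy], ?_⟩
  rw [Drawing.image_map]
  rintro _ ⟨z, hz, rfl⟩
  rcases himg z hz with h | rfl | rfl
  · exact Or.inl (by simpa using h)
  · exact Or.inr (Or.inl (by simp))
  · exact Or.inr (Or.inr (by simp))

/-- Two drawings with free arcs can be glued along their end vertices. -/
theorem HasFreeDrawing.exists_glue {W₁ W₂ : Type*} {G : SimpleGraph V} {K₁ : SimpleGraph W₁}
    {K₂ : SimpleGraph W₂} {ι₁ : W₁ → V} {ι₂ : W₂ → V} (hι₁ : Function.Injective ι₁)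
    (hι₂ : Function.Injective ι₂) (hcov : ∀ v, v ∈ Set.range ι₁ ∨ v ∈ Set.range ι₂)
    {x₁ y₁ : W₁} {x₂ y₂ : W₂} (hx : ι₁ x₁ = ι₂ x₂) (hy : ι₁ y₁ = ι₂ y₂)
    (hcap : ∀ a b, ι₁ a = ι₂ b → a = x₁ ∨ a = y₁)
    (hG : ∀ v w, G.Adj v w → (∃ a b, K₁.Adj a b ∧ ι₁ a = v ∧ ι₁ b = w) ∨
      (∃ a b, K₂.Adj a b ∧ ι₂ a = v ∧ ι₂ b = w) ∨ s(v, w) = s(ι₁ x₁, ι₁ y₁))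
    {R : V → V → V → V → Prop}
    (h₁ : HasFreeDrawing K₁ (fun a b c d => R (ι₁ a) (ι₁ b) (ι₁ c) (ι₁ d)) x₁ y₁)
    (h₂ : HasFreeDrawing K₂ (fun a b c d => R (ι₂ a) (ι₂ b) (ι₂ c) (ι₂ d)) x₂ y₂) :
    ∃ D : Drawing G, D.Obeys R := by
  obtain ⟨D₁, hD₁, hx₁, hy₁, hi₁⟩ := h₁.exists_upper
  obtain ⟨D₂, hD₂, hx₂, hy₂, hi₂⟩ := h₂.exists_lower
  obtain ⟨D, hD, hp, -, hi⟩ := Drawing.exists_glue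
    (G := K₁.map ι₁ ⊔ K₂.map ι₂) hι₁ hι₂ hcov D₁ D₂ (by
        intro a b hab
        rcases hcap a b hab with rfl | rfl
        · rw [hx₁, ← hx₂, hι₂ (hx.symm.trans hab)]
        · rw [hy₁, ← hy₂, hι₂ (hy.symm.trans hab)]) (by
        rintro z ⟨hz₁, hz₂⟩
        have : z = (-1, 0) ∨ z = (1, 0) := by
          rcases hi₁ z hz₁ with h | h
          · rcases hi₂ z hz₂ with h' | h'
            · exact absurd h h'.not_gt
            · exact h'
          · exact h
        rcases this with rfl | rfl
        · exact ⟨x₁, x₂, hx, hx₁, hx₂⟩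
        · exact ⟨y₁, y₂, hy, hy₁, hy₂⟩) (by
        rintro v w (h | h)
        · obtain ⟨a, b, hab, rfl, rfl⟩ := (SimpleGraph.map_adj ⟨ι₁, hι₁⟩ K₁ _ _).1 h
          exact Or.inl ⟨a, b, hab, rfl, rfl⟩
        · obtain ⟨a, b, hab, rfl, rfl⟩ := (SimpleGraph.map_adj ⟨ι₂, hι₂⟩ K₂ _ _).1 h
          exact Or.inr ⟨a, b, hab, rfl, rfl⟩) hD₁ hD₂
  have hseg := isArc_graph (g := fun _ => 0) continuous_const (show (-1 : ℝ) < 1 by norm_num)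
  obtain ⟨D', hD', -⟩ := D.exists_add_arc (G := G) (x := ι₁ x₁) (y := ι₁ y₁) hD
    (by rwa [hp, hp, hx₁, hy₁]) (by
        rw [hp, hp, hx₁, hy₁]
        rintro _ ⟨⟨u, -, rfl⟩, hz⟩
        rcases hi hz with hz | hz
        · simpa using hi₁ _ hz
        · simpa using hi₂ _ hz) (by
        intro v w hvw
        rcases hG v w hvw with ⟨a, b, hab, rfl, rfl⟩ | ⟨a, b, hab, rfl, rfl⟩ | h
        · exact Or.inl (Or.inl ((SimpleGraph.map_adj ⟨ι₁, hι₁⟩ K₁ _ _).2 ⟨a, b, hab, rfl, rfl⟩))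
        · exact Or.inl (Or.inr ((SimpleGraph.map_adj ⟨ι₂, hι₂⟩ K₂ _ _).2 ⟨a, b, hab, rfl, rfl⟩))
        · exact Or.inr h)
  exact ⟨D', hD'⟩

/-- The drawing of an isolated vertex. -/
def isolatedDrawing (z : ℝ × ℝ) : Drawing (⊥ : SimpleGraph Unit) where
  pos _ := z
  pos_inj _ _ _ := rfl
  arc _ := ∅
  arc_curve e he := by simp at he
  arc_avoid e he := by simp at he
  arc_finite_inter e he := by simp at he

theorem image_isolatedDrawing (z : ℝ × ℝ) : (isolatedDrawing z).image = {z} := by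
  ext w
  simp [Drawing.mem_image_iff, isolatedDrawing, eq_comm]

theorem obeys_isolatedDrawing (z : ℝ × ℝ) (R : Unit → Unit → Unit → Unit → Prop) :
    (isolatedDrawing z).Obeys R :=
  ⟨⟨fun _ _ _ _ _ h => absurd h.1 (by simp), fun _ _ _ h => absurd h.1 (by simp)⟩,
    fun _ _ _ _ _ h => absurd h.1 (by simp)⟩

/-- A common neighbour of the ends of a free arc can be added to the drawing. -/
theorem HasFreeDrawing.exists_add_vertex {G : SimpleGraph V} {K : SimpleGraph W} {ι : W → V}
    (hι : Function.Injective ι) {t : V} (ht : ∀ a, ι a ≠ t) (hcov : ∀ v, v ∈ Set.range ι ∨ v = t)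
    {x y : W} (hG : ∀ v w, G.Adj v w → (∃ a b, K.Adj a b ∧ ι a = v ∧ ι b = w) ∨
      s(v, w) = s(ι x, ι y) ∨ s(v, w) = s(ι x, t) ∨ s(v, w) = s(t, ι y))
    {R : V → V → V → V → Prop}
    (h : HasFreeDrawing K (fun a b c d => R (ι a) (ι b) (ι c) (ι d)) x y) :
    ∃ D : Drawing G, D.Obeys R := by
  obtain ⟨D, hD, hx, hy, hi⟩ := h.exists_upper
  obtain ⟨D₀, hD₀, hp, hpt, hi₀⟩ := Drawing.exists_glue (G := K.map ι) (ι₁ := ι)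
    (ι₂ := fun _ : Unit => t) (R := R) hι (fun _ _ _ => rfl)
    (fun v => (hcov v).imp_right fun h => ⟨(), h.symm⟩) D (isolatedDrawing (0, -1))
    (fun a _ h => absurd h (ht a)) (by
        rw [image_isolatedDrawing]
        rintro z ⟨hz, rfl⟩
        rcases hi _ hz with h | h | h <;> norm_num at h) (by
        intro v w hvw
        obtain ⟨a, b, hab, rfl, rfl⟩ := (SimpleGraph.map_adj ⟨ι, hι⟩ K _ _).1 hvw
        exact Or.inl ⟨a, b, hab, rfl, rfl⟩) hD (obeys_isolatedDrawing _ _)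
  have hpt : D₀.pos t = (0, -1) := hpt ()
  replace hi₀ : ∀ z ∈ D₀.image, 0 < z.2 ∨ z = (-1, 0) ∨ z = (1, 0) ∨ z = (0, -1) := by
    intro z hz
    rcases hi₀ hz with hz | hz
    · rcases hi z hz with h | h | h <;> simp [h]
    · rw [image_isolatedDrawing] at hz
      simp [show z = _ from hz]
  have seg₁ := isArc_graph (g := fun _ => 0) continuous_const (show (-1 : ℝ) < 1 by norm_num)
  have seg₂ := isArc_graph (g := fun u => -1 - u) (by fun_prop) (show (-1 : ℝ) < 0 by norm_num)
  have seg₃ := isArc_graph (g := fun u => u - 1) (by fun_prop) (show (0 : ℝ) < 1 by norm_num)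
  norm_num at seg₂ seg₃
  obtain ⟨D₁, hD₁, hp₁, hi₁⟩ := D₀.exists_add_arc
    (G := K.map ι ⊔ SimpleGraph.edge (ι x) (ι y)) (x := ι x) (y := ι y) hD₀
    (by rwa [hp, hp, hx, hy]) (by
        rw [hp, hp, hx, hy]
        rintro _ ⟨⟨u, ⟨hu, hu'⟩, rfl⟩, hz⟩
        simpa using hi₀ _ hz) (by
        rintro v w (h | h)
        · exact Or.inl h
        · exact Or.inr (Sym2.eq_iff.2 ((SimpleGraph.edge_adj _ _ _ _).1 h).1))
  obtain ⟨D₂, hD₂, hp₂, hi₂⟩ := D₁.exists_add_arc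
    (G := K.map ι ⊔ SimpleGraph.edge (ι x) (ι y) ⊔ SimpleGraph.edge (ι x) t)
    (x := ι x) (y := t) hD₁
    (by rwa [hp₁, hp₁, hp, hx, hpt]) (by
        rw [hp₁, hp₁, hp, hx, hpt]
        rintro _ ⟨⟨u, ⟨hu, hu'⟩, rfl⟩, hz⟩
        rcases hi₁ hz with hz | ⟨w, ⟨hw, hw'⟩, h⟩
        · rcases hi₀ _ hz with h | h | h | h
          · simp only at h
            linarith
          · exact Or.inl h
          · simp only [Prod.mk.injEq] at h
            linarith
          · exact Or.inr h
        · simp only [Prod.mk.injEq] at h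
          have : u = -1 := by linarith
          simp [this]) (by
        rintro v w (h | h)
        · exact Or.inl h
        · exact Or.inr (Sym2.eq_iff.2 ((SimpleGraph.edge_adj _ _ _ _).1 h).1))
  obtain ⟨D₃, hD₃, -⟩ := D₂.exists_add_arc (G := G) (x := t) (y := ι y) hD₂
    (by rwa [hp₂, hp₂, hp₁, hp₁, hp, hy, hpt]) (by
        rw [hp₂, hp₂, hp₁, hp₁, hp, hy, hpt]
        rintro _ ⟨⟨u, ⟨hu, hu'⟩, rfl⟩, hz⟩
        rcases hi₂ hz with hz | ⟨w, ⟨hw, hw'⟩, h⟩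
        · rcases hi₁ hz with hz | ⟨w, ⟨hw, hw'⟩, h⟩
          · rcases hi₀ _ hz with h | h | h | h
            · exact absurd h (by simpa using hu')
            · simp only [Prod.mk.injEq] at h
              linarith
            · exact Or.inr h
            · exact Or.inl h
          · simp only [Prod.mk.injEq] at h
            have : u = 1 := by linarith
            simp [this]
        · simp only [Prod.mk.injEq] at h
          have : u = 0 := by linarith
          simp [this]) (by
        intro v w hvw
        rcases hG v w hvw with ⟨a, b, hab, rfl, rfl⟩ | h | h | h
        · exact Or.inl (Or.inl (Or.inl
            ((SimpleGraph.map_adj ⟨ι, hι⟩ K _ _).2 ⟨a, b, hab, rfl, rfl⟩)))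
        · exact Or.inl (Or.inl (Or.inr ((SimpleGraph.edge_adj _ _ _ _).2
            ⟨Sym2.eq_iff.1 h, hvw.ne⟩)))
        · exact Or.inl (Or.inr ((SimpleGraph.edge_adj _ _ _ _).2 ⟨Sym2.eq_iff.1 h, hvw.ne⟩))
        · exact Or.inr h)
  exact ⟨D₃, hD₃⟩

/-! ### Rerouting an uncrossed edge -/

/-- The part of the region between the segment from `(-1, 0)` to `(1, 0)` and the parabola
`v = 1 - u ^ 2` to the right of the line `u = u₀`. -/
def lens (u₀ : ℝ) : Set (ℝ × ℝ) :=
  {z | u₀ < z.1 ∧ 0 < z.2 ∧ z.2 < 1 - z.1 ^ 2}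

theorem exists_arcs_compl_lens {u₀ v w : ℝ} (hu : -1 < u₀) (hu' : u₀ < 1) (hv : 0 < v)
    (hv' : v < 1 - u₀ ^ 2) (hw : 0 < w) (hw' : w < 1 - u₀ ^ 2) (hvw : v ≠ w) :
    ∃ P Q, IsArc P (u₀, v) (1, 0) ∧ IsArc Q (u₀, w) (1, 0) ∧ P ∩ Q ⊆ {(1, 0)} ∧
      (∀ z ∈ P, u₀ ≤ z.1 ∧ z ∉ lens u₀) ∧ ∀ z ∈ Q, u₀ ≤ z.1 ∧ z ∉ lens u₀ := by
  wlog h : w < v generalizing v w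
  · obtain ⟨P, Q, hP, hQ, hPQ, hPl, hQl⟩ :=
      this hw hw' hv hv' hvw.symm (lt_of_le_of_ne (not_lt.1 h) hvw)
    exact ⟨Q, P, hQ, hP, by rwa [Set.inter_comm], hQl, hPl⟩
  have hP := (isArc_vertical (u := u₀) hv').trans
    (isArc_graph (g := fun u => 1 - u ^ 2) (by fun_prop) hu') (by
      rintro _ ⟨⟨y, ⟨hy, hy'⟩, rfl⟩, u, -, h⟩
      simp only [Prod.mk.injEq] at h
      obtain ⟨rfl, rfl⟩ := h
      rfl)
  have hQ := (isArc_vertical (u := u₀) hw).symm.trans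
    (isArc_graph (g := fun _ => 0) continuous_const hu') (by
      rintro _ ⟨⟨y, ⟨hy, hy'⟩, rfl⟩, u, -, h⟩
      simp only [Prod.mk.injEq] at h
      obtain ⟨rfl, rfl⟩ := h
      rfl)
  refine ⟨_, _, by simpa using hP, hQ, ?_, ?_, ?_⟩
  · rintro _ ⟨⟨y, ⟨hy, hy'⟩, rfl⟩ | ⟨y, ⟨hy, hy'⟩, rfl⟩, ⟨x, ⟨hx, hx'⟩, h⟩ | ⟨x, ⟨hx, hx'⟩, h⟩⟩ <;>
      simp only [Prod.mk.injEq] at h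
    · linarith
    · linarith
    · rw [← h.1] at h
      linarith
    · have : y = 1 := by nlinarith
      simp [this]
  · rintro _ (⟨y, ⟨hy, hy'⟩, rfl⟩ | ⟨y, ⟨hy, hy'⟩, rfl⟩)
    · exact ⟨le_rfl, fun h => lt_irrefl _ h.1⟩
    · exact ⟨hy, fun h => lt_irrefl _ h.2.2⟩
  · rintro _ (⟨y, ⟨hy, hy'⟩, rfl⟩ | ⟨y, ⟨hy, hy'⟩, rfl⟩)
    · exact ⟨le_rfl, fun h => lt_irrefl _ h.1⟩
    · exact ⟨hy, fun h => lt_irrefl _ h.2.1⟩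

/-- An initial part of an arc that enters the lens at `(-1, 0)`. -/
theorem IsArc.exists_initial_in_lens {α β : Set (ℝ × ℝ)} {p c : ℝ × ℝ} {Φ : ℝ × ℝ → ℝ × ℝ}
    {u₀ : ℝ} (hβ : IsArc β c p) (hαβ : α ∩ β ⊆ {p}) (hc : ContinuousOn Φ β)
    (hi : Set.InjOn Φ β) (hp : Φ p = (-1, 0))
    (hΦ : ∀ z ∉ α, 0 < (Φ z).2 ∧ (Φ z).2 < 1 - (Φ z).1 ^ 2) (hu : -1 < u₀)
    (huc : u₀ < (Φ c).1) :
    ∃ v, 0 < v ∧ v < 1 - u₀ ^ 2 ∧ ∃ B ⊆ Φ '' β, IsArc B (Φ c) (u₀, v) ∧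
      ∀ z ∈ B, z ≠ (u₀, v) → z ∈ lens u₀ := by
  have key : ∀ z ∈ Φ '' β, -1 < z.1 → 0 < z.2 ∧ z.2 < 1 - z.1 ^ 2 := by
    rintro _ ⟨z, hz, rfl⟩ h
    refine hΦ z fun hzα => ?_
    rw [hαβ ⟨hzα, hz⟩, hp] at h
    exact lt_irrefl _ h
  obtain ⟨⟨u, v⟩, hz, B, hB, hBa, rfl, hBu⟩ := (hβ.image hc hi).exists_first_le continuous_fst huc
    (by simpa [hp] using hu.le)
  refine ⟨v, (key _ hz hu).1, (key _ hz hu).2, B, hB, hBa, fun z hzB hne => ?_⟩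
  have h := hBu z hzB hne
  exact ⟨h, key z (hB hzB) (hu.trans h)⟩

/-- If three arcs `α`, `β` and `δ` ending in `b`, `c` and `a` meet only in their common starting
point `p`, then up to an embedding of `X` the point `b` can be joined to both `a` and `c`
by arcs meeting only in `b`. -/
theorem IsArc.exists_double {X α β δ : Set (ℝ × ℝ)} {a b c p : ℝ × ℝ} (hα : IsArc α p b)
    (hβ : IsArc β c p) (hδ : IsArc δ a p) (hX : IsCompact X) (haX : a ∈ X) (hbX : b ∈ X)
    (hcX : c ∈ X) (hXα : X ∩ α ⊆ {b}) (hXβ : X ∩ β ⊆ {c}) (hXδ : X ∩ δ ⊆ {a})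
    (hαβ : α ∩ β ⊆ {p}) (hαδ : α ∩ δ ⊆ {p}) (hβδ : β ∩ δ ⊆ {p}) :
    ∃ (Φ : ℝ × ℝ → ℝ × ℝ) (E F : Set (ℝ × ℝ)), ContinuousOn Φ X ∧ Set.InjOn Φ X ∧
      IsArc E (Φ a) (Φ b) ∧ IsArc F (Φ c) (Φ b) ∧ E ∩ Φ '' X ⊆ {Φ a, Φ b} ∧
      F ∩ Φ '' X ⊆ {Φ c, Φ b} ∧ E ∩ F ⊆ {Φ b} := by
  obtain ⟨Φ, hΦc, hΦi, hp, hb, hΦ⟩ := hα.exists_lens_map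
  have hsub : ∀ {Y : Set (ℝ × ℝ)} {q : ℝ × ℝ}, Y ∩ α ⊆ {q} → q = p ∨ q = b →
      Y ⊆ αᶜ ∪ {p, b} := by
    intro Y q h hq z hz
    by_cases hzα : z ∈ α
    · exact Or.inr (h ⟨hz, hzα⟩ ▸ hq)
    · exact Or.inl hzα
  have hX' := hsub hXα (Or.inr rfl)
  have hβ' := hsub ((Set.inter_comm _ _).trans_subset hαβ) (Or.inl rfl)
  have hδ' := hsub ((Set.inter_comm _ _).trans_subset hαδ) (Or.inl rfl)
  have hlt : ∀ z ∈ X, -1 < (Φ z).1 := by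
    intro z hz
    by_cases hzα : z ∈ α
    · rw [hXα ⟨hz, hzα⟩, hb]
      norm_num
    · have := hΦ z hzα
      nlinarith
  obtain ⟨x, hxX, hmin⟩ := hX.exists_isMinOn ⟨b, hbX⟩
    (continuous_fst.comp_continuousOn (hΦc.mono hX'))
  obtain ⟨u₀, hu, hux⟩ := exists_between (hlt x hxX)
  have hu₀ : ∀ z ∈ X, u₀ < (Φ z).1 := fun z hz => hux.trans_le (hmin hz)
  have hu1 : u₀ < 1 := by simpa [hb] using hu₀ b hbX
  have hXl : ∀ z ∈ Φ '' X, z = (1, 0) ∨ z ∈ lens u₀ := by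
    rintro _ ⟨z, hz, rfl⟩
    by_cases hzα : z ∈ α
    · rw [hXα ⟨hz, hzα⟩]
      exact Or.inl hb
    · exact Or.inr ⟨hu₀ z hz, hΦ z hzα⟩
  obtain ⟨v, hv, hv', B, hB, hBa, hBl⟩ := hβ.exists_initial_in_lens hαβ (hΦc.mono hβ')
    (hΦi.mono hβ') hp hΦ hu (hu₀ c hcX)
  obtain ⟨w, hw, hw', C, hC, hCa, hCl⟩ := hδ.exists_initial_in_lens hαδ (hΦc.mono hδ')
    (hΦi.mono hδ') hp hΦ hu (hu₀ a haX)
  have hBu : ∀ z ∈ B, u₀ ≤ z.1 := fun z hz => by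
    by_cases h : z = (u₀, v)
    · rw [h]
    · exact (hBl z hz h).1.le
  have hCB : C ∩ B = ∅ := by
    refine Set.eq_empty_of_forall_notMem fun z hz => ?_
    obtain ⟨y, hy, rfl⟩ := hB hz.2
    obtain ⟨y', hy', h⟩ := hC hz.1
    have := hBu _ hz.2
    obtain rfl := hΦi (hδ' hy') (hβ' hy) h
    rw [hβδ ⟨hy, hy'⟩, hp] at this
    exact absurd hu this.not_gt
  have hvw : v ≠ w := fun h =>
    Set.eq_empty_iff_forall_notMem.1 hCB (u₀, v) ⟨h ▸ hCa.right_mem, hBa.right_mem⟩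
  obtain ⟨P, Q, hP, hQ, hPQ, hPl, hQl⟩ := exists_arcs_compl_lens hu hu1 hv hv' hw hw' hvw
  have hne : ∀ y : ℝ, (u₀, y) ≠ ((1, 0) : ℝ × ℝ) := fun y h => hu1.ne (congrArg Prod.fst h)
  have hBP : ∀ z ∈ B, z ∈ P → z = (u₀, v) := fun z hz hz' =>
    by_contra fun h => (hPl z hz').2 (hBl z hz h)
  have hBQ : ∀ z ∈ B, z ∉ Q := fun z hz hz' => by
    by_cases h : z = (u₀, v)
    · exact hne v (hPQ ⟨hP.left_mem, h ▸ hz'⟩)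
    · exact (hQl z hz').2 (hBl z hz h)
  have hCQ : ∀ z ∈ C, z ∈ Q → z = (u₀, w) := fun z hz hz' =>
    by_contra fun h => (hQl z hz').2 (hCl z hz h)
  have hCP : ∀ z ∈ C, z ∉ P := fun z hz hz' => by
    by_cases h : z = (u₀, w)
    · exact hne w (hPQ ⟨h ▸ hz', hQ.left_mem⟩)
    · exact (hPl z hz').2 (hCl z hz h)
  refine ⟨Φ, C ∪ Q, B ∪ P, hΦc.mono hX', hΦi.mono hX', hb ▸ hCa.trans hQ fun z hz => hCQ z hz.1 hz.2,
    hb ▸ hBa.trans hP fun z hz => hBP z hz.1 hz.2, ?_, ?_, ?_⟩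
  · rintro z ⟨hz | hz, hzX⟩
    · obtain ⟨y, hy, rfl⟩ := hC hz
      obtain ⟨y', hy', h⟩ := hzX
      obtain rfl := hΦi (hX' hy') (hδ' hy) h
      exact Or.inl (congrArg Φ (hXδ ⟨hy', hy⟩))
    · exact Or.inr (((hXl z hzX).resolve_right (hQl z hz).2).trans hb.symm)
  · rintro z ⟨hz | hz, hzX⟩
    · obtain ⟨y, hy, rfl⟩ := hB hz
      obtain ⟨y', hy', h⟩ := hzX
      obtain rfl := hΦi (hX' hy') (hβ' hy) h
      exact Or.inl (congrArg Φ (hXβ ⟨hy', hy⟩))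
    · exact Or.inr (((hXl z hzX).resolve_right (hPl z hz).2).trans hb.symm)
  · rintro z ⟨hz | hz, hz' | hz'⟩
    · exact absurd (show z ∈ C ∩ B from ⟨hz, hz'⟩) (by simp [hCB])
    · exact absurd hz' (hCP z hz)
    · exact absurd hz (hBQ z hz')
    · exact (hPQ ⟨hz', hz⟩).trans hb.symm

/-- If an arc leads from the vertex `c` to an inner point of an uncrossed edge `ab`, then there
is a drawing with a free arc between `c` and `b`. -/
theorem Drawing.Obeys.hasFreeDrawing [Finite W] {K : SimpleGraph W} {D : Drawing K}
    {R : W → W → W → W → Prop} (hD : D.Obeys R) {a b c : W} (hab : K.Adj a b) (hca : c ≠ a)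
    (hcb : c ≠ b) (hcross : ∀ e q, ¬ D.Crosses s(a, b) e q) {p : ℝ × ℝ} (hp : p ∈ D.arc s(a, b))
    (hpv : p ∉ Set.range D.pos) {β : Set (ℝ × ℝ)} (hβ : IsArc β (D.pos c) p)
    (hβD : β ∩ D.image ⊆ {D.pos c, p}) : HasFreeDrawing K R c b := by
  have hne : ∀ v, p ≠ D.pos v := fun v h => hpv ⟨v, h.symm⟩
  obtain ⟨δ, α, harc, hδα, hδ, hα⟩ := (D.arc_curve s(a, b) hab a b rfl).split hp (hne a) (hne b)
  have hαe : α ⊆ D.arc s(a, b) := harc ▸ Set.subset_union_right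
  have hδe : δ ⊆ D.arc s(a, b) := harc ▸ Set.subset_union_left
  have haα : D.pos a ∉ α := fun h =>
    hne a (show D.pos a ∈ ({p} : Set _) from hδα ▸ ⟨hδ.left_mem, h⟩).symm
  have hbδ : D.pos b ∉ δ := fun h =>
    hne b (show D.pos b ∈ ({p} : Set _) from hδα ▸ ⟨h, hα.right_mem⟩).symm
  have hce : D.pos c ∉ D.arc s(a, b) := fun h =>
    (Sym2.mem_iff.1 (D.arc_avoid _ hab _ h)).elim hca hcb
  have hK : ∀ x y, (K.deleteEdges {s(a, b)}).Adj x y → K.Adj (id x) (id y) := fun x y h =>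
    (SimpleGraph.deleteEdges_adj.1 h).1
  set D₀ : Drawing (K.deleteEdges {s(a, b)}) := D.restrict Function.injective_id hK with hD₀
  have hD₀R : D₀.Obeys R := hD.restrict Function.injective_id hK
  have himg : D₀.image ⊆ D.image := by
    intro z hz
    rcases D₀.mem_image_iff.1 hz with ⟨v, rfl⟩ | ⟨e, he, hz⟩
    · exact D.pos_mem_image v
    · exact D.arc_subset_image (map_mem_edgeSet hK he) hz
  have hmeet : ∀ z ∈ D₀.image, z ∈ D.arc s(a, b) → z = D.pos a ∨ z = D.pos b := by
    intro z hz hz'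
    have hv : ∀ v, D.pos v = z → z = D.pos a ∨ z = D.pos b := by
      rintro v rfl
      rcases Sym2.mem_iff.1 (D.arc_avoid _ hab _ hz') with rfl | rfl
      · exact Or.inl rfl
      · exact Or.inr rfl
    rcases D₀.mem_image_iff.1 hz with ⟨v, h⟩ | ⟨e, he, hz⟩
    · exact hv v h
    · have he' : e ∈ K.edgeSet ∧ e ≠ s(a, b) := by
        rw [SimpleGraph.edgeSet_deleteEdges] at he
        exact he
      have hz : z ∈ D.arc e := by simpa [hD₀, Drawing.restrict] using hz
      rcases D.mem_of_mem_arc_inter hab he'.1 he'.2.symm hz' hz with ⟨v, h, -⟩ | h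
      · exact hv v h
      · exact absurd h (hcross _ _)
  have hβe : D.arc s(a, b) ∩ β ⊆ {p} := by
    rintro z ⟨hz, hz'⟩
    rcases hβD ⟨hz', D.arc_subset_image hab hz⟩ with rfl | h
    · exact absurd hz hce
    · exact h
  obtain ⟨Φ, E, F, hc, hi, hE, hF, hEX, hFX, hEF⟩ := hα.exists_double (X := D₀.image) hβ hδ
    D₀.isCompact_image (D₀.pos_mem_image a) (D₀.pos_mem_image b) (D₀.pos_mem_image c)
    (fun z hz => (hmeet z hz.1 (hαe hz.2)).resolve_left fun h => haα (h ▸ hz.2))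
    (fun z hz => (hβD ⟨hz.2, himg hz.1⟩).resolve_right fun h => by
      subst h
      exact (hmeet _ hz.1 hp).elim (hne a) (hne b))
    (fun z hz => (hmeet z hz.1 (hδe hz.2)).resolve_right fun h => hbδ (h ▸ hz.2))
    (fun z hz => hβe ⟨hαe hz.1, hz.2⟩) (by rw [Set.inter_comm, hδα])
    (fun z hz => hβe ⟨hδe hz.2, hz.1⟩)
  obtain ⟨D', hD', hpos, himg'⟩ := (D₀.map Φ hc hi).exists_add_arc (G := K) (x := a) (y := b)
    (hD₀R.map Φ hc hi) hE (by rw [Drawing.image_map]; exact hEX) (fun v w hvw => by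
      rw [SimpleGraph.deleteEdges_adj]
      exact (em _).symm.imp_left fun h => ⟨hvw, h⟩)
  have hpos : ∀ v, D'.pos v = Φ (D.pos v) := hpos
  refine ⟨D', hD', F, by rwa [hpos, hpos], ?_⟩
  rw [hpos, hpos]
  rintro z ⟨hz, hz'⟩
  rw [Drawing.image_map] at himg'
  rcases himg' hz' with h | h
  · exact hFX ⟨hz, h⟩
  · exact Or.inr (hEF ⟨h, hz⟩)

/-! ### Drawings of one side of a separation -/

/-- The edges of `G` with at least one end outside the range of `ι`. -/
def outerGraph (G : SimpleGraph V) (ι : W → V) : SimpleGraph V where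
  Adj v w := G.Adj v w ∧ (v ∉ Set.range ι ∨ w ∉ Set.range ι)
  symm := ⟨fun _ _ h => ⟨h.1.symm, h.2.symm⟩⟩
  loopless := ⟨fun _ h => h.1.ne rfl⟩

theorem Drawing.exists_arc_of_reachable {G H : SimpleGraph V} (D : Drawing G) (hH : H ≤ G)
    {u v : V} (h : H.Reachable u v) (huv : u ≠ v) :
    ∃ A, IsArc A (D.pos u) (D.pos v) ∧ ∀ z ∈ A, ∃ e ∈ H.edgeSet, z ∈ D.arc e := by
  obtain ⟨p⟩ := h
  induction p with
  | nil => exact absurd rfl huv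
  | @cons u w v huw p ih =>
    have h1 := D.arc_curve s(u, w) (hH huw) u w rfl
    by_cases hwv : w = v
    · subst hwv
      exact ⟨_, h1, fun z hz => ⟨_, huw, hz⟩⟩
    · obtain ⟨A, hA, hAH⟩ := ih hwv
      obtain ⟨B, hB, hBa⟩ := h1.join hA (D.pos_inj.ne huv)
      exact ⟨B, hBa, fun z hz => (hB hz).elim (fun h => ⟨_, huw, h⟩) (hAH z)⟩

section

variable {G : SimpleGraph V} {ι : W → V} {x y : W} {R : V → V → V → V → Prop}

/-- The part of `G` induced by `ι`, without the edge joining `x` and `y`. -/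
def innerGraph (G : SimpleGraph V) (ι : W → V) (x y : W) : SimpleGraph W :=
  (G.comap ι).deleteEdges {s(x, y)}

theorem innerGraph_adj {a b : W} :
    (innerGraph G ι x y).Adj a b ↔ G.Adj (ι a) (ι b) ∧ s(a, b) ≠ s(x, y) := by
  rw [innerGraph, SimpleGraph.deleteEdges_adj]
  rfl

theorem adj_of_innerGraph_adj (a b : W) (h : (innerGraph G ι x y).Adj a b) :
    G.Adj (ι a) (ι b) :=
  (innerGraph_adj.1 h).1

theorem eq_or_eq_of_mem_outerGraph_edge
    (hout : ∀ v ∉ Set.range ι, ∀ a, G.Adj v (ι a) → a = x ∨ a = y) {e : Sym2 V}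
    (he : e ∈ (outerGraph G ι).edgeSet) {a : W} (ha : ι a ∈ e) : a = x ∨ a = y := by
  induction e with
  | h v w =>
    obtain ⟨hvw, h⟩ := he
    rcases Sym2.mem_iff.1 ha with rfl | rfl
    · exact hout w (h.resolve_left fun h => h ⟨a, rfl⟩) a hvw.symm
    · exact hout v (h.resolve_right fun h => h ⟨a, rfl⟩) a hvw

/-- If no inner edge crosses an outer edge, then an outer path is a free arc. -/
theorem Drawing.Obeys.hasFreeDrawing_of_not_crosses {D : Drawing G} (hD : D.Obeys R)
    (hι : Function.Injective ι) (hxy : x ≠ y)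
    (hout : ∀ v ∉ Set.range ι, ∀ a, G.Adj v (ι a) → a = x ∨ a = y)
    (hreach : (outerGraph G ι).Reachable (ι x) (ι y))
    (hcross : ∀ e ∈ (innerGraph G ι x y).edgeSet, ∀ e' ∈ (outerGraph G ι).edgeSet, ∀ p,
      ¬ D.Crosses (e.map ι) e' p) :
    HasFreeDrawing (innerGraph G ι x y) (fun a b c d => R (ι a) (ι b) (ι c) (ι d)) x y := by
  have hle : outerGraph G ι ≤ G := fun _ _ h => h.1
  obtain ⟨A, hA, hAout⟩ := D.exists_arc_of_reachable hle hreach (hι.ne hxy)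
  refine ⟨D.restrict hι adj_of_innerGraph_adj, hD.restrict hι _, A, hA, ?_⟩
  rintro z ⟨hzA, hz⟩
  obtain ⟨e', he', hze'⟩ := hAout z hzA
  have he'G : e' ∈ G.edgeSet := SimpleGraph.edgeSet_mono hle he'
  have hvert : ∀ a, D.pos (ι a) = z → ι a ∈ e' → z = D.pos (ι x) ∨ z = D.pos (ι y) := by
    rintro a rfl ha
    rcases eq_or_eq_of_mem_outerGraph_edge hout he' ha with rfl | rfl
    · exact Or.inl rfl
    · exact Or.inr rfl
  rcases (Drawing.mem_image_iff _).1 hz with ⟨a, rfl⟩ | ⟨e, he, hz⟩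
  · exact hvert a rfl (D.arc_avoid _ he'G _ hze')
  · have he₀ := map_mem_edgeSet adj_of_innerGraph_adj he
    have hne : e.map ι ≠ e' := by
      rintro rfl
      induction e with
      | h a b => exact he'.2.elim (fun h => h ⟨a, rfl⟩) fun h => h ⟨b, rfl⟩
    rcases D.mem_of_mem_arc_inter he₀ he'G hne hz hze' with ⟨v, hv, hve, hve'⟩ | h
    · obtain ⟨a, -, rfl⟩ := Sym2.mem_map.1 hve
      exact hvert a hv hve'
    · exact absurd h (hcross e he e' he' z)

/-- If the inner edge `ab` crosses an outer edge `cd` and the ends of these edges are on a common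
4-cycle, then `ab` can be rerouted. -/
theorem Drawing.Obeys.hasFreeDrawing_of_crosses [Finite W] {D : Drawing G} (hD : D.Obeys R)
    (hι : Function.Injective ι)
    (hout : ∀ v ∉ Set.range ι, ∀ a, G.Adj v (ι a) → a = x ∨ a = y) {a b : W} {c d : V}
    {p : ℝ × ℝ} (hab : (innerGraph G ι x y).Adj a b) (hd : d ∉ Set.range ι)
    (hcross : D.Crosses s(ι a, ι b) s(c, d) p) (hac : G.Adj (ι a) c) (hbd : G.Adj (ι b) d) :
    HasFreeDrawing (innerGraph G ι x y) (fun a b c d => R (ι a) (ι b) (ι c) (ι d)) x y := by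
  have hb := hout d hd b hbd.symm
  have hcd : G.Adj c d := hcross.2.1
  obtain ⟨c, rfl⟩ : c ∈ Set.range ι := by
    by_contra hc
    refine (innerGraph_adj.1 hab).2 (Sym2.eq_iff.2 ?_)
    have hne := hab.ne
    rcases hout c hc a hac.symm with rfl | rfl <;> rcases hb with rfl | rfl <;> simp_all
  have hc := hout d hd c hcd.symm
  have hcb : c ≠ b := by
    rintro rfl
    exact hD.1.2 _ _ _ hcross (ι c) (by simp) (by simp)
  have hca : c ≠ a := by
    rintro rfl
    exact hD.1.2 _ _ _ hcross (ι c) (by simp) (by simp)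
  have hdmem : ∀ e : Sym2 W, d ∉ e.map ι := fun e h => by
    obtain ⟨w, -, rfl⟩ := Sym2.mem_map.1 h
    exact hd ⟨w, rfl⟩
  have hpv := hcross.2.2.2.2.2
  obtain ⟨β, _, harc, -, hβ, -⟩ := (D.arc_curve _ hcross.2.1 _ _ rfl).split hcross.2.2.2.2.1
    (fun h => hpv ⟨_, h.symm⟩) (fun h => hpv ⟨_, h.symm⟩)
  have key : HasFreeDrawing (innerGraph G ι x y)
      (fun a b c d => R (ι a) (ι b) (ι c) (ι d)) c b := by
    refine (hD.restrict hι adj_of_innerGraph_adj).hasFreeDrawing hab hca hcb (p := p) ?_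
      hcross.2.2.2.1 (fun ⟨w, hw⟩ => hpv ⟨_, hw⟩) hβ ?_
    · intro e q h
      obtain ⟨h1, -⟩ := hD.1.1 _ _ _ _ _ h.of_restrict hcross
      exact hdmem e (h1 ▸ by simp)
    · rintro z ⟨hzβ, hz⟩
      have hzcd : z ∈ D.arc s(ι c, d) := harc ▸ Or.inl hzβ
      have hvert : ∀ w, D.pos (ι w) = z → ι w ∈ s(ι c, d) → z = D.pos (ι c) ∨ z = p := by
        rintro w rfl hw
        rcases Sym2.mem_iff.1 hw with h | rfl
        · exact Or.inl (h ▸ rfl)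
        · exact absurd ⟨w, rfl⟩ hd
      rcases (Drawing.mem_image_iff _).1 hz with ⟨w, rfl⟩ | ⟨e, he, hz⟩
      · exact hvert w rfl (D.arc_avoid _ hcross.2.1 _ hzcd)
      · have he₀ := map_mem_edgeSet adj_of_innerGraph_adj he
        have hne : e.map ι ≠ s(ι c, d) := fun h => hdmem e (h ▸ by simp)
        rcases D.mem_of_mem_arc_inter he₀ hcross.2.1 hne hz hzcd with ⟨v, hv, hve, hvcd⟩ | h
        · obtain ⟨w, -, rfl⟩ := Sym2.mem_map.1 hve
          exact hvert w hv hvcd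
        · exact Or.inr (hD.1.1 _ _ _ _ _ h.symm hcross.symm).2
  rcases hb with rfl | rfl <;> rcases hc with rfl | rfl
  · exact absurd rfl hcb
  · exact key.symm
  · exact key
  · exact absurd rfl hcb

/-- If the two vertices `x` and `y` separate the range of `ι` from the rest of `G`, which contains
a path joining them, then the inner part has a drawing with a free arc between `x` and `y`. -/
theorem Drawing.Obeys.hasFreeDrawing_innerGraph [Finite W] {D : Drawing G} (hD : D.Obeys R)
    (hR : ∀ a b c d, R a b c d → G.Adj a c ∧ G.Adj b d ∨ G.Adj a d ∧ G.Adj b c)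
    (hι : Function.Injective ι) (hxy : x ≠ y)
    (hout : ∀ v ∉ Set.range ι, ∀ a, G.Adj v (ι a) → a = x ∨ a = y)
    (hreach : (outerGraph G ι).Reachable (ι x) (ι y)) :
    HasFreeDrawing (innerGraph G ι x y) (fun a b c d => R (ι a) (ι b) (ι c) (ι d)) x y := by
  by_cases h : ∀ e ∈ (innerGraph G ι x y).edgeSet, ∀ e' ∈ (outerGraph G ι).edgeSet, ∀ p,
      ¬ D.Crosses (e.map ι) e' p
  · exact hD.hasFreeDrawing_of_not_crosses hι hxy hout hreach h
  push Not at h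
  obtain ⟨e, he, e', he', p, hp⟩ := h
  obtain ⟨c, d, rfl, hd⟩ : ∃ c d, e' = s(c, d) ∧ d ∉ Set.range ι := by
    induction e' with
    | h c d => exact he'.2.elim (fun h => ⟨d, c, Sym2.eq_swap, h⟩) fun h => ⟨c, d, rfl, h⟩
  induction e with
  | h a b =>
    rcases hR _ _ _ _ (hD.2 _ _ _ _ _ hp) with ⟨h1, h2⟩ | ⟨h1, h2⟩
    · exact hD.hasFreeDrawing_of_crosses hι hout he hd hp h1 h2
    · rw [Sym2.map_mk, Sym2.eq_swap] at hp
      exact hD.hasFreeDrawing_of_crosses hι hout he.symm hd hp h2 h1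

end

/-! ### Separations -/

section

variable {G : SimpleGraph V} {S : Set CrossingType} {X X₁ X₂ T : Set V} {s s' : V}

theorem hasCrossingType_comap {ι : W → V} {a b c d : W} {t : CrossingType} :
    HasCrossingType (G.comap ι) a b c d t ↔ HasCrossingType G (ι a) (ι b) (ι c) (ι d) t := by
  cases t <;> rfl

theorem HasCrossingType.exists_four_cycle {a b c d : V} {t : CrossingType}
    (h : HasCrossingType G a b c d t) (ht : t ∈ goodTypes) :
    G.Adj a c ∧ G.Adj b d ∨ G.Adj a d ∧ G.Adj b c := by
  rcases ht with rfl | rfl | rfl <;> simp only [HasCrossingType] at h <;> tauto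

/-- The graph `H` without the edge `xy` has a drawing, with crossing types in `S` with respect
to `H`, with a free arc between `x` and `y`. -/
def FreelyRestricted (H : SimpleGraph W) (S : Set CrossingType) (x y : W) : Prop :=
  HasFreeDrawing (innerGraph H id x y) (fun a b c d => ∃ t ∈ S, HasCrossingType H a b c d t) x y

theorem SRestricted.freelyRestricted_comap [Finite W] (h : SRestricted G S) (hS : S ⊆ goodTypes)
    {ι : W → V} {x y : W} (hι : Function.Injective ι) (hxy : x ≠ y)
    (hout : ∀ v ∉ Set.range ι, ∀ a, G.Adj v (ι a) → a = x ∨ a = y)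
    (hreach : (outerGraph G ι).Reachable (ι x) (ι y)) :
    FreelyRestricted (G.comap ι) S x y := by
  obtain ⟨D, hD⟩ := h
  have hD : D.Obeys fun a b c d => ∃ t ∈ S, HasCrossingType G a b c d t := hD
  simp only [FreelyRestricted, hasCrossingType_comap]
  exact hD.hasFreeDrawing_innerGraph
    (fun _ _ _ _ ⟨_, ht, h⟩ => h.exists_four_cycle (hS ht)) hι hxy hout hreach

theorem augment_adj_inl {a b : X} :
    (augment G X s s').Adj (Sum.inl a) (Sum.inl b) ↔ G.Adj a b := by
  simp only [augment, SimpleGraph.fromRel_adj]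
  constructor
  · rintro ⟨-, (⟨u, v, hu, hv, h⟩ | ⟨-, -, -, h⟩) | ⟨u, v, hu, hv, h⟩ | ⟨-, -, -, h⟩⟩
    · rwa [Sum.inl_injective hu, Sum.inl_injective hv]
    · exact absurd h Sum.inl_ne_inr
    · rw [Sum.inl_injective hu, Sum.inl_injective hv]
      exact h.symm
    · exact absurd h Sum.inl_ne_inr
  · exact fun h => ⟨fun hab => h.ne (congrArg _ (Sum.inl_injective hab)),
      Or.inl (Or.inl ⟨a, b, rfl, rfl, h⟩)⟩

theorem augment_adj_inr {a : X} :
    (augment G X s s').Adj (Sum.inl a) (Sum.inr ()) ↔ (a : V) = s ∨ (a : V) = s' := by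
  simp [augment, SimpleGraph.fromRel_adj]

theorem comap_augment : (augment G X s s').comap Sum.inl = G.comap ((↑) : X → V) := by
  ext a b
  exact augment_adj_inl

theorem SRestricted.freelyRestricted_of_augment [Finite V] (hS : S ⊆ goodTypes) {x y : X}
    (hxy : x ≠ y) (h : SRestricted (augment G X x y) S) :
    FreelyRestricted (G.comap ((↑) : X → V)) S x y := by
  rw [← comap_augment (G := G) (X := X) (s := (x : V)) (s' := (y : V))]
  have hadj : ∀ a : X, a = x ∨ a = y →
      (outerGraph (augment G X x y) Sum.inl).Adj (Sum.inl a) (Sum.inr ()) := fun a ha =>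
    ⟨augment_adj_inr.2 (ha.imp (congrArg _) (congrArg _)), Or.inr (by simp)⟩
  refine h.freelyRestricted_comap hS Sum.inl_injective hxy ?_
    ((hadj x (Or.inl rfl)).reachable.trans (hadj y (Or.inr rfl)).symm.reachable)
  rintro (v | ⟨⟩) hv a ha
  · exact absurd ⟨v, rfl⟩ hv
  · exact (augment_adj_inr.1 ha.symm).imp Subtype.ext Subtype.ext

theorem FreelyRestricted.sRestricted_augment {x y : X}
    (h : FreelyRestricted (G.comap ((↑) : X → V)) S x y) : SRestricted (augment G X x y) S := by
  rw [← comap_augment (G := G) (X := X) (s := (x : V)) (s' := (y : V))] at h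
  simp only [FreelyRestricted, hasCrossingType_comap] at h
  refine h.exists_add_vertex (G := augment G X x y) (t := Sum.inr ())
    (R := fun a b c d => ∃ t ∈ S, HasCrossingType (augment G X x y) a b c d t)
    Sum.inl_injective (fun _ => Sum.inl_ne_inr) ?_ ?_
  · rintro (v | ⟨⟩) <;> simp
  · rintro (v | ⟨⟩) (w | ⟨⟩) hvw
    · by_cases hc : s(v, w) = s(x, y)
      · exact Or.inr (Or.inl (congrArg (Sym2.map Sum.inl) hc))
      · exact Or.inl ⟨v, w, innerGraph_adj.2 ⟨hvw, hc⟩, rfl, rfl⟩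
    · rcases augment_adj_inr.1 hvw with h | h
      · simp [Subtype.ext h]
      · simp [Subtype.ext h, Sym2.eq_swap]
    · rcases augment_adj_inr.1 hvw.symm with h | h
      · simp [Subtype.ext h, Sym2.eq_swap]
      · simp [Subtype.ext h]
    · exact absurd rfl hvw.ne

theorem IsSeparation.symm (h : IsSeparation G T X₁ X₂) : IsSeparation G T X₂ X₁ := by
  obtain ⟨h1, h2, h3, h4, h5⟩ := h
  refine ⟨by rwa [Set.union_comm], by rwa [Set.inter_comm], h4, h3, fun u hu v hv p => ?_⟩
  obtain ⟨w, hw, hwp⟩ := h5 v hv u hu p.reverse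
  exact ⟨w, hw, by simpa using hwp⟩

theorem IsSeparation.mem_of_adj (h : IsSeparation G T X₁ X₂) {v a : V} (hv : v ∉ X₁) (ha : a ∈ X₁)
    (hva : G.Adj v a) : a ∈ T := by
  obtain ⟨h1, h2, -, -, h5⟩ := h
  by_contra haT
  have hvX₂ : v ∈ X₂ := ((Set.ext_iff.1 h1 v).2 trivial).resolve_left hv
  have hvT : v ∉ T := fun h => hv (h2 ▸ h : v ∈ X₁ ∩ X₂).1
  obtain ⟨w, hw, hwp⟩ := h5 a ⟨ha, haT⟩ v ⟨hvX₂, hvT⟩ hva.symm.toWalk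
  simp only [SimpleGraph.Walk.support_cons, SimpleGraph.Walk.support_nil, List.mem_cons,
    List.not_mem_nil, or_false] at hwp
  rcases hwp with rfl | rfl
  · exact haT hw
  · exact hvT hw

theorem outerGraph_reachable {ι : W → V} {x y : W}
    (hout : ∀ v ∉ Set.range ι, ∀ a, G.Adj v (ι a) → a = x ∨ a = y) (hxy : ι x ≠ ι y)
    (hconn : (G.induce {ι y}ᶜ).Preconnected) {v : V} (hv : v ∉ Set.range ι) :
    (outerGraph G ι).Reachable v (ι x) := by
  have key : ∀ (u w : ({ι y}ᶜ : Set V)), (G.induce {ι y}ᶜ).Walk u w → w.1 = ι x →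
      u.1 ∉ Set.range ι → (outerGraph G ι).Reachable u (ι x) := by
    intro u w p hw
    induction p with
    | nil => exact fun hu => absurd ⟨x, hw.symm⟩ hu
    | @cons u z w huz p ih =>
      intro hu
      have h : (outerGraph G ι).Adj u z := ⟨huz, Or.inl hu⟩
      by_cases hz : z.1 ∈ Set.range ι
      · obtain ⟨a, ha⟩ := hz
        rcases hout u hu a (ha ▸ huz) with rfl | rfl
        · rw [ha]
          exact h.reachable
        · exact absurd ha.symm z.2
      · exact h.reachable.trans (ih hw hz)
  have hvy : v ∈ ({ι y}ᶜ : Set V) := fun h => hv ⟨y, (show v = ι y from h).symm⟩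
  obtain ⟨p⟩ := hconn ⟨v, hvy⟩ ⟨ι x, hxy⟩
  exact key _ _ p rfl hv

theorem IsSeparation.sRestricted_augment [Finite V] (h : SRestricted G S) (hS : S ⊆ goodTypes)
    (hG : KConnected 2 G) (hss : s ≠ s') (hsep : IsSeparation G {s, s'} X₁ X₂) :
    SRestricted (augment G X₁ s s') S := by
  have hT : ∀ w ∈ ({s, s'} : Set V), w ∈ X₁ := fun w hw => (hsep.2.1 ▸ hw : w ∈ X₁ ∩ X₂).1
  have hxy : (⟨s, hT s (by simp)⟩ : X₁) ≠ ⟨s', hT s' (by simp)⟩ := fun h =>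
    hss (congrArg Subtype.val h)
  have hout : ∀ v ∉ Set.range ((↑) : X₁ → V), ∀ a : X₁, G.Adj v a →
      a = ⟨s, hT s (by simp)⟩ ∨ a = ⟨s', hT s' (by simp)⟩ := by
    intro v hv a hva
    rw [Subtype.range_coe] at hv
    exact (hsep.mem_of_adj hv a.2 hva).imp Subtype.ext Subtype.ext
  obtain ⟨v, hvX₂, hvT⟩ := hsep.2.2.2.1
  have hv : v ∉ Set.range ((↑) : X₁ → V) := by
    rw [Subtype.range_coe]
    exact fun hv => hvT (hsep.2.1 ▸ ⟨hv, hvX₂⟩)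
  have hconn : ∀ w : V, (G.induce {w}ᶜ).Preconnected := fun w =>
    (hG.2 {w} (by simp)).preconnected
  have h1 := outerGraph_reachable hout hss (hconn s') hv
  have h2 := outerGraph_reachable (fun v hv a h => (hout v hv a h).symm) hss.symm (hconn s) hv
  exact (h.freelyRestricted_comap hS Subtype.val_injective hxy hout
    (h1.symm.trans h2)).sRestricted_augment

theorem IsSeparation.sRestricted [Finite V] (hS : S ⊆ goodTypes) (hss : s ≠ s')
    (hsep : IsSeparation G {s, s'} X₁ X₂) (h₁ : SRestricted (augment G X₁ s s') S)
    (h₂ : SRestricted (augment G X₂ s s') S) : SRestricted G S := by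
  have hT : ∀ w, w = s ∨ w = s' → w ∈ X₁ ∩ X₂ := fun w hw => hsep.2.1.symm ▸ hw
  have hs := hT s (Or.inl rfl)
  have hs' := hT s' (Or.inr rfl)
  have hcov : ∀ v, v ∈ X₁ ∨ v ∈ X₂ := fun v => (Set.ext_iff.1 hsep.1 v).2 trivial
  have f₁ := SRestricted.freelyRestricted_of_augment hS (x := ⟨s, hs.1⟩) (y := ⟨s', hs'.1⟩)
    (fun h => hss (congrArg Subtype.val h)) h₁
  have f₂ := SRestricted.freelyRestricted_of_augment hS (x := ⟨s, hs.2⟩) (y := ⟨s', hs'.2⟩)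
    (fun h => hss (congrArg Subtype.val h)) h₂
  simp only [FreelyRestricted, hasCrossingType_comap] at f₁ f₂
  refine f₁.exists_glue (G := G) (R := fun a b c d => ∃ t ∈ S, HasCrossingType G a b c d t)
    Subtype.val_injective Subtype.val_injective
    (fun v => (hcov v).imp (fun h => ⟨⟨v, h⟩, rfl⟩) fun h => ⟨⟨v, h⟩, rfl⟩) rfl rfl ?_ ?_ f₂
  · intro a b hab
    have : (a : V) ∈ ({s, s'} : Set V) := hsep.2.1 ▸ ⟨a.2, hab ▸ b.2⟩
    exact this.imp Subtype.ext Subtype.ext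
  · intro v w hvw
    by_cases hc : s(v, w) = s(s, s')
    · exact Or.inr (Or.inr hc)
    by_cases h : v ∈ X₁ ∧ w ∈ X₁
    · exact Or.inl ⟨⟨v, h.1⟩, ⟨w, h.2⟩, innerGraph_adj.2
        ⟨hvw, fun h => hc (congrArg (Sym2.map Subtype.val) h)⟩, rfl, rfl⟩
    · have hX₂ : ∀ {a b}, a ∉ X₁ → G.Adj a b → b ∈ X₂ := fun {a b} ha hab => by
        by_cases hb : b ∈ X₁
        · exact (hT b (hsep.mem_of_adj ha hb hab)).2
        · exact (hcov b).resolve_left hb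
      have : v ∈ X₂ ∧ w ∈ X₂ := by
        by_cases hv : v ∈ X₁
        · have hw : w ∉ X₁ := fun hw => h ⟨hv, hw⟩
          exact ⟨hX₂ hw hvw.symm, (hcov w).resolve_left hw⟩
        · exact ⟨(hcov v).resolve_left hv, hX₂ hv hvw⟩
      exact Or.inr (Or.inl ⟨⟨v, this.1⟩, ⟨w, this.2⟩, innerGraph_adj.2
        ⟨hvw, fun h => hc (congrArg (Sym2.map Subtype.val) h)⟩, rfl, rfl⟩)

end

end

/-- **Splitting at a 2-separator.** Assume `S ⊆ {full, almost-full, bowtie}`.  Let `G` be a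
2-connected graph, `{s,s'}` a 2-separator of `G` and `(X₁, X₂)` a separation induced by
`{s,s'}`.  Let `Gᵢ := G[Xᵢ] + {s tᵢ, tᵢ s'}` where `tᵢ` is a new vertex.  Then `G` is
`S`-restricted if and only if both `G₁` and `G₂` are `S`-restricted. -/
theorem srestricted_iff_two_separator_parts {V : Type*} [Fintype V] (G : SimpleGraph V)
    (S : Set CrossingType) (hS : S ⊆ goodTypes)
    (hG : KConnected 2 G) (s s' : V) (hss : s ≠ s') (X₁ X₂ : Set V)
    (hsep : IsSeparation G {s, s'} X₁ X₂) :
    SRestricted G S ↔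
      SRestricted (augment G X₁ s s') S ∧ SRestricted (augment G X₂ s s') S := by
  exact ⟨fun h => ⟨hsep.sRestricted_augment h hS hG hss,
    hsep.symm.sRestricted_augment h hS hG hss⟩, fun h => hsep.sRestricted hS hss h.1 h.2⟩

end OnePlanarity
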